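/- arXiv:2311.00110 — 11 statements merged into one kernel-verified Lean document; each statement's English description precedes it below -/
import Mathlib

section
/- Let n ≥ 3 and let d₁ ≥ d₂ ≥ ⋯ ≥ dₙ > 0 be positive integers. If there exists a triangular multigraph on n vertices v₁,…,vₙ with deg(vᵢ) = dᵢ for all i, then (1) d₁ + d₂ + ⋯ + dₙ is even, and (2) d₁ ≤ Σ_{i=2}^{n} (dᵢ − 1). -/
/-- A multigraph on `Fin n` (symmetric multiplicity function with zero diagonal)
is triangular if every edge of positive multiplicity lies in a triangle. -/
def Triangular {n : ℕ} (m : Fin n → Fin n → ℕ) : Prop :=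
  ∀ i j : Fin n, i ≠ j → 0 < m i j →
    ∃ k : Fin n, k ≠ i ∧ k ≠ j ∧ 0 < m i k ∧ 0 < m j k

/-- The sum of all entries of a symmetric matrix with zero diagonal is even. -/
theorem even_sum_sum_of_symm {V : Type*} [Fintype V] (m : V → V → ℕ)
    (hsymm : ∀ i j, m i j = m j i) (hloop : ∀ i, m i i = 0) :
    Even (∑ i, ∑ j, m i j) := by
  rw [← Fintype.sum_prod_type', ← ZMod.natCast_eq_zero_iff_even, Nat.cast_sum]
  refine Finset.sum_involution (fun a _ => a.swap) (fun a _ => ?_) (fun a _ ha hswap => ha ?_)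
    (fun _ _ => Finset.mem_univ _) (fun a _ => a.swap_swap)
  · simp only [Prod.fst_swap, Prod.snd_swap, hsymm a.2 a.1]
    exact CharTwo.add_self_eq_zero _
  · have h : a.2 = a.1 := congrArg Prod.fst hswap
    simp [h, hloop]

/-- In a triangular multigraph, the edges joining `i` to another vertex `v` do not exhaust
the degree of `i`, unless that degree is zero. -/
theorem Triangular.le_degree_sub_one {n : ℕ} {m : Fin n → Fin n → ℕ} (htri : Triangular m)
    (hsymm : ∀ i j, m i j = m j i) {v i : Fin n} (hne : i ≠ v) :
    m v i ≤ ∑ j, m i j - 1 := by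
  rcases Nat.eq_zero_or_pos (m v i) with h | h
  · omega
  · obtain ⟨k, hkv, -, -, hik⟩ := htri v i hne.symm h
    have hpair : m i v + m i k ≤ ∑ j, m i j := by
      rw [← Finset.sum_pair hkv.symm]
      exact Finset.sum_le_sum_of_subset (Finset.subset_univ _)
    rw [hsymm v i]
    omega

theorem stmt_0 (n : ℕ) (hn : 3 ≤ n) (d : Fin n → ℕ)
    (hanti : ∀ i j : Fin n, i ≤ j → d j ≤ d i)
    (hpos : ∀ i : Fin n, 0 < d i)
    (m : Fin n → Fin n → ℕ)
    (hsymm : ∀ i j : Fin n, m i j = m j i)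
    (hloop : ∀ i : Fin n, m i i = 0)
    (htri : Triangular m)
    (hdeg : ∀ i : Fin n, ∑ j, m i j = d i) :
    Even (∑ i, d i) ∧
      d ⟨0, by omega⟩ ≤ ∑ i ∈ Finset.univ.erase (⟨0, by omega⟩ : Fin n), (d i - 1) := by
  simp only [← hdeg]
  refine ⟨even_sum_sum_of_symm m hsymm hloop, ?_⟩
  rw [← Finset.sum_erase Finset.univ (hloop _)]
  exact Finset.sum_le_sum fun i hi =>
    htri.le_degree_sub_one hsymm (Finset.ne_of_mem_erase hi)
end

section
/- Let n ≥ 3 and let (d₁,…,dₙ) be a sequence of integers satisfying (i) d₁ ≥ d₂ ≥ ⋯ ≥ dₙ ≥ 4, (ii) d₁ + ⋯ + dₙ is even, and (iii) d₁ ≤ Σ_{i=2}^{n} (dᵢ − 1). Then there exists a triangular multigraph on n vertices v₁,…,vₙ with deg(vᵢ) = dᵢ for all i ∈ [n]. -/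
/-- `f` is the degree function of a loopless multigraph on `Fin n`. -/
def LooplessRealizable {n : ℕ} (f : Fin n → ℕ) : Prop :=
  ∃ m : Fin n → Fin n → ℕ,
    (∀ i j, m i j = m j i) ∧ (∀ i, m i i = 0) ∧ ∀ i, ∑ j, m i j = f i

/-- `f` is the degree function of a triangular loopless multigraph on `Fin n`. -/
def TriangularRealizable {n : ℕ} (f : Fin n → ℕ) : Prop :=
  ∃ m : Fin n → Fin n → ℕ,
    (∀ i j, m i j = m j i) ∧ (∀ i, m i i = 0) ∧ Triangular m ∧ ∀ i, ∑ j, m i j = f i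

theorem TriangularRealizable.add {n : ℕ} {f g : Fin n → ℕ} (hf : TriangularRealizable f)
    (hg : TriangularRealizable g) : TriangularRealizable (fun i => f i + g i) := by
  obtain ⟨a, as, az, atri, ad⟩ := hf
  obtain ⟨b, bs, bz, btri, bd⟩ := hg
  refine ⟨fun i j => a i j + b i j, fun i j => by simp only [as i j, bs i j],
    fun i => by simp [az, bz], ?_, fun i => by rw [Finset.sum_add_distrib, ad, bd]⟩
  intro i j hij hpos
  dsimp only at hpos ⊢
  have hor : 0 < a i j ∨ 0 < b i j := by omega
  rcases hor with h | h
  · obtain ⟨k, h1, h2, h3, h4⟩ := atri i j hij h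
    exact ⟨k, h1, h2, by omega, by omega⟩
  · obtain ⟨k, h1, h2, h3, h4⟩ := btri i j hij h
    exact ⟨k, h1, h2, by omega, by omega⟩

/-- A function with even sum, none of whose values exceeds half of the sum, is the degree
function of a loopless multigraph. -/
theorem looplessRealizable_of_le_half {n : ℕ} (h : ℕ) (e : Fin n → ℕ)
    (hsum : ∑ i, e i = 2 * h) (hle : ∀ i, e i ≤ h) : LooplessRealizable e := by
  induction h generalizing e with
  | zero =>
    refine ⟨fun _ _ => 0, fun _ _ => rfl, fun _ => rfl, fun i => ?_⟩
    have := hle i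
    simp
    omega
  | succ h ih =>
    have hne : (Finset.univ : Finset (Fin n)).Nonempty := by
      rw [Finset.nonempty_iff_ne_empty]
      intro h0
      rw [h0] at hsum
      simp at hsum
    obtain ⟨u, -, hu⟩ := Finset.exists_max_image Finset.univ e hne
    have hu' := Finset.add_sum_erase Finset.univ e (Finset.mem_univ u)
    have hne2 : (Finset.univ.erase u).Nonempty := by
      rw [Finset.nonempty_iff_ne_empty]
      intro h0
      rw [h0] at hu'
      have := hle u
      simp at hu'
      omega
    obtain ⟨w, hw, hwmax⟩ := Finset.exists_max_image (Finset.univ.erase u) e hne2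
    have hw' := Finset.add_sum_erase _ e hw
    have hwu : w ≠ u := Finset.ne_of_mem_erase hw
    have hwpos : 0 < e w := by
      by_contra h0
      have : ∑ x ∈ Finset.univ.erase u, e x = 0 :=
        Finset.sum_eq_zero fun x hx => by have := hwmax x hx; omega
      have := hle u
      omega
    have hupos : 0 < e u := lt_of_lt_of_le hwpos (hu w (Finset.mem_univ w))
    let δ : Fin n → ℕ := fun i => (if i = u then 1 else 0) + (if i = w then 1 else 0)
    have hδ : ∀ i, δ i ≤ e i := by
      intro i
      simp only [δ]
      by_cases h1 : i = u
      · subst h1; simp [hwu.symm]; omega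
      · by_cases h2 : i = w
        · subst h2; simp [h1]; omega
        · simp [h1, h2]
    have hδsum : ∑ i, δ i = 2 := by simp [δ, Finset.sum_add_distrib]
    have hsub : ∑ i, (e i - δ i) = 2 * h := by
      have : ∑ i, (e i - δ i) + ∑ i, δ i = ∑ i, e i := by
        rw [← Finset.sum_add_distrib]
        exact Finset.sum_congr rfl fun i _ => Nat.sub_add_cancel (hδ i)
      omega
    have hle' : ∀ i, e i - δ i ≤ h := by
      intro i
      have hi := hle i
      by_cases h1 : i = u
      · have : 1 ≤ δ i := by simp [δ, h1]
        omega
      · by_cases h2 : i = w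
        · have : 1 ≤ δ i := by simp [δ, h2]
          omega
        · have hiw : i ∈ (Finset.univ.erase u).erase w := by simp [h1, h2]
          have a1 := Finset.single_le_sum (f := e) (fun _ _ => Nat.zero_le _) hiw
          have a2 := hu i (Finset.mem_univ i)
          have a3 := hwmax i (Finset.mem_of_mem_erase hiw)
          omega
    obtain ⟨m, ms, mz, md⟩ := ih _ hsub hle'
    refine ⟨fun i j => m i j + ((if i = u then if j = w then 1 else 0 else 0) +
      (if i = w then if j = u then 1 else 0 else 0)), fun i j => ?_, fun i => ?_, fun i => ?_⟩
    · simp only [ms i j]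
      split_ifs <;> simp_all
    · simp only [mz]
      split_ifs <;> simp_all
    · rw [Finset.sum_add_distrib, md, Finset.sum_add_distrib]
      have : (∑ j, if i = u then if j = w then 1 else 0 else 0) +
          (∑ j, if i = w then if j = u then 1 else 0 else 0) = δ i := by
        simp only [δ]
        split_ifs <;> simp
      rw [this]
      exact Nat.sub_add_cancel (hδ i)

/-- Every integer between the sums of `lo` and `hi` is the sum of a function between them. -/
theorem exists_sum_eq_of_le_of_le {ι : Type*} [DecidableEq ι] (T : Finset ι) (lo hi : ι → ℕ)
    (hlh : ∀ i ∈ T, lo i ≤ hi i) (X : ℕ) (hlo : ∑ i ∈ T, lo i ≤ X) (hX : X ≤ ∑ i ∈ T, hi i) :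
    ∃ e : ι → ℕ, (∀ i ∈ T, lo i ≤ e i ∧ e i ≤ hi i) ∧ ∑ i ∈ T, e i = X := by
  induction X, hlo using Nat.le_induction with
  | base => exact ⟨lo, fun i hi => ⟨le_rfl, hlh i hi⟩, rfl⟩
  | succ X _ ih =>
    obtain ⟨e, he, hs⟩ := ih (by omega)
    obtain ⟨i, hiT, hlt⟩ : ∃ i ∈ T, e i < hi i := Finset.exists_lt_of_sum_lt (by omega)
    refine ⟨fun j => e j + if j = i then 1 else 0, fun j hj => ?_, ?_⟩
    · have := he j hj
      dsimp only
      split_ifs with h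
      · subst h; omega
      · simpa using this
    · rw [Finset.sum_add_distrib, hs]
      simp [hiT]

/-- A vertex `v` joined to all of `T`, where every vertex of `T` has a neighbour in `T`. -/
theorem triangularRealizable_cone {n : ℕ} (v : Fin n) (T : Finset (Fin n)) (hv : v ∉ T)
    (d e : Fin n → ℕ) (he : LooplessRealizable (fun i => if i ∈ T then e i else 0))
    (hpos : ∀ i ∈ T, 1 ≤ e i) (hlt : ∀ i ∈ T, e i < d i)
    (hsum : d v + ∑ i ∈ T, e i = ∑ i ∈ T, d i) :
    TriangularRealizable (fun i => if i ∈ insert v T then d i else 0) := by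
  obtain ⟨m, ms, mz, md⟩ := he
  have hout : ∀ i j, 0 < m i j → i ∈ T := by
    intro i j h
    by_contra hi
    have h1 := md i
    simp only [if_neg hi] at h1
    have := Finset.single_le_sum (f := m i) (fun _ _ => Nat.zero_le _) (Finset.mem_univ j)
    omega
  have hnbr : ∀ i ∈ T, ∃ j ∈ T, j ≠ i ∧ 0 < m i j := by
    intro i hi
    have h1 := md i
    simp only [if_pos hi] at h1
    have h2 := hpos i hi
    obtain ⟨j, -, hj⟩ : ∃ j ∈ Finset.univ, m i j ≠ 0 :=
      Finset.exists_ne_zero_of_sum_ne_zero (by omega)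
    have hj' : 0 < m i j := Nat.pos_of_ne_zero hj
    refine ⟨j, hout j i (by rwa [ms]), ?_, hj'⟩
    rintro rfl
    exact hj (mz _)
  let c : Fin n → ℕ := fun i => if i ∈ T then d i - e i else 0
  have hcpos : ∀ i ∈ T, 0 < c i := fun i hi => by
    have := hlt i hi
    simp only [c, if_pos hi]
    omega
  have hcv : c v = 0 := if_neg hv
  have hcsum : ∑ i, c i = d v := by
    have h1 : ∑ i, c i = ∑ i ∈ T, (d i - e i) := by simp [c, Finset.sum_ite_mem]
    have h2 : ∑ i ∈ T, (d i - e i) + ∑ i ∈ T, e i = ∑ i ∈ T, d i := by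
      rw [← Finset.sum_add_distrib]
      exact Finset.sum_congr rfl fun i hi => Nat.sub_add_cancel (hlt i hi).le
    omega
  let M : Fin n → Fin n → ℕ := fun i j =>
    m i j + ((if i = v then c j else 0) + (if j = v then c i else 0))
  have hMs : ∀ i j, M i j = M j i := fun i j => by
    simp only [M, ms i j]
    omega
  have hMv : ∀ i ∈ T, 0 < M i v := fun i hi => by
    have := hcpos i hi
    simp only [M, if_true]
    omega
  have hMm : ∀ i j, m i j ≤ M i j := fun i j => Nat.le_add_right _ _
  have hMcase : ∀ i j, 0 < M i j →
      0 < m i j ∨ (i = v ∧ j ∈ T) ∨ (j = v ∧ i ∈ T) := by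
    intro i j h
    by_contra! hc
    obtain ⟨h1, h2, h3⟩ := hc
    have h4 : (if i = v then c j else 0) = 0 := by
      split_ifs with hi
      · exact if_neg (h2 hi)
      · rfl
    have h5 : (if j = v then c i else 0) = 0 := by
      split_ifs with hj
      · exact if_neg (h3 hj)
      · rfl
    simp only [M, h4, h5] at h
    omega
  refine ⟨M, hMs, fun i => ?_, ?_, fun i => ?_⟩
  · simp only [M, mz]
    split_ifs with h
    · simp [h, hcv]
    · rfl
  · intro i j hij hpos'
    rcases hMcase i j hpos' with h | ⟨rfl, hj⟩ | ⟨rfl, hi⟩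
    · have hi := hout i j h
      have hj := hout j i (by rwa [ms])
      exact ⟨v, fun h => hv (h ▸ hi), fun h => hv (h ▸ hj), hMv i hi, hMv j hj⟩
    · obtain ⟨k, hk, hkj, hm⟩ := hnbr j hj
      refine ⟨k, fun h => hv (h ▸ hk), hkj, ?_, lt_of_lt_of_le hm (hMm _ _)⟩
      rw [hMs]
      exact hMv k hk
    · obtain ⟨k, hk, hki, hm⟩ := hnbr i hi
      refine ⟨k, hki, fun h => hv (h ▸ hk), lt_of_lt_of_le hm (hMm _ _), ?_⟩
      rw [hMs]
      exact hMv k hk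
  · simp only [M, Finset.sum_add_distrib, md]
    by_cases hiv : i = v
    · subst hiv
      simp [hv, hcsum, hcv]
    · by_cases hi : i ∈ T
      · have := hlt i hi
        simp [hiv, hi, c]
        omega
      · simp [hiv, hi, c]

/-- The values `min (d i - 1) h` on `T` sum to at least `2 * h`. -/
theorem two_mul_le_sum_min {ι : Type*} [DecidableEq ι] (T : Finset ι) (d : ι → ℕ) (D h : ℕ)
    (h2 : ∀ i ∈ T, 2 ≤ d i) (hD : ∀ i ∈ T, d i ≤ D) (hcard : T.card ≤ D)
    (hsum : D + 2 * h = ∑ i ∈ T, d i) :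
    2 * h ≤ ∑ i ∈ T, min (d i - 1) h := by
  by_cases hbig : ∃ a ∈ T, h ≤ d a - 1
  · obtain ⟨a, ha, hah⟩ := hbig
    rw [← Finset.add_sum_erase T _ ha, min_eq_right hah]
    by_cases hbig2 : ∃ b ∈ T.erase a, h ≤ d b - 1
    · obtain ⟨b, hb, hbh⟩ := hbig2
      rw [← Finset.add_sum_erase _ _ hb, min_eq_right hbh]
      omega
    · push Not at hbig2
      have h1 : ∑ i ∈ T.erase a, d i ≤ ∑ i ∈ T.erase a, 2 * min (d i - 1) h :=
        Finset.sum_le_sum fun i hi => by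
          have := hbig2 i hi
          have := h2 i (Finset.mem_of_mem_erase hi)
          omega
      rw [← Finset.mul_sum] at h1
      have := hD a ha
      rw [← Finset.add_sum_erase T d ha] at hsum
      omega
  · push Not at hbig
    have h1 : ∑ i ∈ T, d i = ∑ i ∈ T, (min (d i - 1) h + 1) :=
      Finset.sum_congr rfl fun i hi => by
        have := hbig i hi
        have := h2 i hi
        omega
    rw [Finset.sum_add_distrib, Finset.sum_const, smul_eq_mul, mul_one] at h1
    omega

theorem sum_sub_one_add_card {ι : Type*} (T : Finset ι) (d : ι → ℕ) (h1 : ∀ i ∈ T, 1 ≤ d i) :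
    ∑ i ∈ T, (d i - 1) + T.card = ∑ i ∈ T, d i := by
  rw [Finset.card_eq_sum_ones, ← Finset.sum_add_distrib]
  exact Finset.sum_congr rfl fun i hi => Nat.sub_add_cancel (h1 i hi)

/-- The case of a vertex `v` of degree at least the number of other vertices. -/
theorem triangularRealizable_of_card_le {n : ℕ} (v : Fin n) (T : Finset (Fin n)) (hv : v ∉ T)
    (d : Fin n → ℕ) (hT : 2 ≤ T.card) (h2 : ∀ i ∈ T, 2 ≤ d i) (hmax : ∀ i ∈ T, d i ≤ d v)
    (heven : Even (d v + ∑ i ∈ T, d i)) (hle : d v ≤ ∑ i ∈ T, (d i - 1))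
    (hcard : T.card ≤ d v) :
    TriangularRealizable (fun i => if i ∈ insert v T then d i else 0) := by
  have hs := sum_sub_one_add_card T d fun i hi => (by have := h2 i hi; omega)
  obtain ⟨r, hr⟩ := heven
  obtain ⟨h, hh⟩ : ∃ h, d v + 2 * h = ∑ i ∈ T, d i := ⟨r - d v, by omega⟩
  obtain ⟨e, he, hes⟩ := exists_sum_eq_of_le_of_le T (fun _ => 1) (fun i => min (d i - 1) h)
    (fun i hi => by have := h2 i hi; simp only [le_min_iff]; omega) (2 * h)
    (by simp; omega) (two_mul_le_sum_min T d (d v) h h2 hmax hcard hh)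
  refine triangularRealizable_cone v T hv d e ?_ (fun i hi => (he i hi).1) ?_ (by omega)
  · refine looplessRealizable_of_le_half h _ (by simpa [Finset.sum_ite_mem] using hes) ?_
    intro i
    split_ifs with hi
    · exact (he i hi).2.trans (min_le_right _ _)
    · exact Nat.zero_le _
  · intro i hi
    have h3 := (he i hi).2.trans (min_le_left _ _)
    have := h2 i hi
    omega

theorem three_mul_card_le_sum_sub_one {ι : Type*} (T : Finset ι) (d : ι → ℕ)
    (h4 : ∀ i ∈ T, 4 ≤ d i) : 3 * T.card ≤ ∑ i ∈ T, (d i - 1) := by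
  have := Finset.card_nsmul_le_sum T (fun i => d i - 1) 3 fun i hi => by
    have := h4 i hi
    omega
  rw [smul_eq_mul] at this
  omega

/-- If `d v` is small compared with the number of other vertices, these can be split into two
large parts, one of which together with `v` has an even degree sum. -/
theorem exists_even_part {ι : Type*} [DecidableEq ι] (v : ι) (T : Finset ι) (d : ι → ℕ)
    (h4 : ∀ i ∈ T, 4 ≤ d i) (hmax : ∀ i ∈ T, d i ≤ d v) (h4v : 4 ≤ d v)
    (heven : Even (d v + ∑ i ∈ T, d i)) (hcard : d v < T.card) :
    ∃ U ⊆ T, 2 ≤ U.card ∧ d v ≤ 3 * U.card ∧ Even (d v + ∑ i ∈ U, d i) ∧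
      3 ≤ (T \ U).card ∧ d v ≤ 3 * ((T \ U).card - 1) := by
  obtain ⟨t, ht⟩ : ∃ t, t = max 2 ((d v + 2) / 3) := ⟨_, rfl⟩
  obtain ⟨U, hU, hUc⟩ := Finset.exists_subset_card_eq (s := T) (n := t) (by omega)
  by_cases hev : Even (d v + ∑ i ∈ U, d i)
  · have := Finset.card_sdiff_of_subset hU
    exact ⟨U, hU, by omega, by omega, hev, by omega, by omega⟩
  · obtain ⟨y, hy, hodd⟩ : ∃ y ∈ T \ U, ¬ Even (d y) := by
      by_contra! hall
      apply hev
      rw [← Finset.sum_sdiff hU] at heven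
      have h1 : Even (∑ i ∈ T \ U, d i) := Finset.even_sum _ hall
      grind
    rw [Finset.mem_sdiff] at hy
    have hy4 : d y ≠ 4 := fun h => hodd (by rw [h]; decide)
    have := h4 y hy.1
    have := hmax y hy.1
    have hsub : insert y U ⊆ T := Finset.insert_subset hy.1 hU
    have hc := Finset.card_insert_of_notMem hy.2
    have := Finset.card_sdiff_of_subset hsub
    refine ⟨insert y U, hsub, by omega, by omega, ?_, by omega, by omega⟩
    rw [Finset.sum_insert hy.2]
    grind

theorem triangularRealizable_insert {n : ℕ} (d : Fin n → ℕ) (h4 : ∀ i, 4 ≤ d i) (v : Fin n)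
    (T : Finset (Fin n)) (hv : v ∉ T) (hT : 2 ≤ T.card) (hmax : ∀ i ∈ T, d i ≤ d v)
    (heven : Even (d v + ∑ i ∈ T, d i)) (hle : d v ≤ ∑ i ∈ T, (d i - 1)) :
    TriangularRealizable (fun i => if i ∈ insert v T then d i else 0) := by
  induction hc : T.card using Nat.strong_induction_on generalizing v T with
  | _ c ih =>
    subst hc
    by_cases hcard : T.card ≤ d v
    · exact triangularRealizable_of_card_le v T hv d hT
        (fun i _ => by have := h4 i; omega) hmax heven hle hcard
    obtain ⟨U, hU, hU2, hUv, hUe, hR3, hRv⟩ :=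
      exists_even_part v T d (fun i _ => h4 i) hmax (h4 v) heven (by omega)
    have hcs := Finset.card_sdiff_of_subset hU
    have hUT := Finset.card_le_card hU
    have hfirst := ih U.card (by omega) v U (fun h => hv (hU h)) hU2
      (fun i hi => hmax i (hU hi)) hUe
      (hUv.trans (three_mul_card_le_sum_sub_one U d fun i _ => h4 i)) rfl
    obtain ⟨w, hw, hwmax⟩ := Finset.exists_max_image (T \ U) d
      (Finset.card_pos.mp (by omega))
    have hwc := Finset.card_erase_of_mem hw
    have hwv := hmax w (Finset.mem_sdiff.mp hw).1
    have hsecond := ih ((T \ U).erase w).card (by omega) w ((T \ U).erase w)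
      (Finset.notMem_erase _ _) (by omega)
      (fun i hi => hwmax i (Finset.mem_of_mem_erase hi))
      (by
        rw [Finset.add_sum_erase _ _ hw]
        rw [← Finset.sum_sdiff hU] at heven
        grind)
      (by
        have := three_mul_card_le_sum_sub_one ((T \ U).erase w) d fun i _ => h4 i
        omega) rfl
    rw [Finset.insert_erase hw] at hsecond
    convert hfirst.add hsecond using 2 with i
    by_cases h1 : i = v
    · subst h1
      simp [hv]
    · by_cases h2 : i ∈ U
      · simp [h2, hU h2]
      · simp [h1, h2]

theorem stmt_1 (n : ℕ) (hn : 3 ≤ n) (d : Fin n → ℕ)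
    (hanti : ∀ i j : Fin n, i ≤ j → d j ≤ d i)
    (h4 : ∀ i : Fin n, 4 ≤ d i)
    (heven : Even (∑ i, d i))
    (hd1 : d ⟨0, by omega⟩ ≤ ∑ i ∈ Finset.univ.erase (⟨0, by omega⟩ : Fin n), (d i - 1)) :
    ∃ m : Fin n → Fin n → ℕ,
      (∀ i j : Fin n, m i j = m j i) ∧
      (∀ i : Fin n, m i i = 0) ∧
      Triangular m ∧
      (∀ i : Fin n, ∑ j, m i j = d i) := by
  have hv := Finset.mem_univ (⟨0, by omega⟩ : Fin n)
  have hc := Finset.card_erase_of_mem hv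
  rw [Finset.card_univ, Fintype.card_fin] at hc
  have key := triangularRealizable_insert d h4 ⟨0, by omega⟩ (Finset.univ.erase ⟨0, by omega⟩)
    (Finset.notMem_erase _ _) (by omega) (fun i _ => hanti _ i (Nat.zero_le _))
    (by rwa [Finset.add_sum_erase _ _ hv]) hd1
  rw [Finset.insert_erase hv] at key
  simpa [TriangularRealizable] using key
end

section
/- For a positive integer n, there exists a triangular multigraph on n vertices in which every vertex has degree 3 if and only if n is divisible by 4. -/
section Cubic

variable {n : ℕ} {m : Fin n → Fin n → ℕ}

/-- In a cubic multigraph, distinct neighbours `a`, `b` of `i` joined to it by simple edges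
are complemented by exactly one further neighbour. -/
lemma exists_third_neighbor (hdeg : ∀ i, ∑ j, m i j = 3) {i a b : Fin n} (hab : a ≠ b)
    (ha : m i a = 1) (hb : m i b = 1) :
    ∃ c, c ≠ a ∧ c ≠ b ∧ 0 < m i c ∧ ∀ d, 0 < m i d → d = a ∨ d = b ∨ d = c := by
  have hsum := hdeg i
  rw [← Finset.add_sum_erase _ _ (Finset.mem_univ a),
    ← Finset.add_sum_erase _ _ (Finset.mem_erase.2 ⟨hab.symm, Finset.mem_univ b⟩)] at hsum
  have hone : ∑ j ∈ (Finset.univ.erase a).erase b, m i j = 1 := by omega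
  obtain ⟨c, hc, hpos⟩ : ∃ c ∈ (Finset.univ.erase a).erase b, 0 < m i c := by
    by_contra! h
    rw [Finset.sum_eq_zero fun c hc => Nat.le_zero.1 (h c hc)] at hone
    omega
  simp only [Finset.mem_erase, Finset.mem_univ, and_true] at hc
  refine ⟨c, hc.2, hc.1, hpos, fun d hd => ?_⟩
  by_contra! h
  have hle : ∑ j ∈ ({c, d} : Finset (Fin n)), m i j
      ≤ ∑ j ∈ (Finset.univ.erase a).erase b, m i j :=
    Finset.sum_le_sum_of_subset (by
      intro x
      simp only [Finset.mem_insert, Finset.mem_singleton, Finset.mem_erase, Finset.mem_univ]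
      grind)
  rw [Finset.sum_pair h.2.2.symm] at hle
  omega

lemma neighbor_eq_of_two_le (hdeg : ∀ i, ∑ j, m i j = 3) {i a b : Fin n} (hab : a ≠ b)
    (ha : 2 ≤ m i a) (hb : 0 < m i b) :
    m i b = 1 ∧ ∀ d, 0 < m i d → d = a ∨ d = b := by
  have hsub := fun s : Finset (Fin n) =>
    (Finset.sum_le_sum_of_subset (f := m i) (Finset.subset_univ s)).trans (hdeg i).le
  have hpair := hsub {a, b}
  rw [Finset.sum_pair hab] at hpair
  refine ⟨by omega, fun d hd => ?_⟩
  by_contra! h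
  have htriple := hsub {d, a, b}
  rw [Finset.sum_insert (by simp [h.1, h.2]), Finset.sum_pair hab] at htriple
  omega

/-- A triangular cubic multigraph is simple. -/
lemma Triangular.le_one (htri : Triangular m) (hsymm : ∀ i j, m i j = m j i)
    (hdiag : ∀ i, m i i = 0) (hdeg : ∀ i, ∑ j, m i j = 3) (v a : Fin n) : m v a ≤ 1 := by
  by_contra! h
  have hva : v ≠ a := by rintro rfl; simp [hdiag] at h
  obtain ⟨b, hbv, hba, hvb, hab⟩ := htri v a hva (by omega)
  obtain ⟨hvb1, hv⟩ := neighbor_eq_of_two_le hdeg hba.symm h hvb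
  obtain ⟨hab1, ha⟩ := neighbor_eq_of_two_le hdeg hbv.symm (hsymm v a ▸ h) hab
  obtain ⟨c, hcv, hca, hbc, hb⟩ :=
    exists_third_neighbor hdeg hva (hsymm v b ▸ hvb1) (hsymm a b ▸ hab1)
  have hbc' : b ≠ c := by rintro rfl; simp [hdiag] at hbc
  obtain ⟨k, hkb, hkc, hbk, hck⟩ := htri b c hbc' hbc
  rw [hsymm] at hck
  rcases hb k hbk with rfl | rfl | rfl
  · rcases hv c hck with rfl | rfl <;> contradiction
  · rcases ha c hck with rfl | rfl <;> contradiction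
  · contradiction

/-- In a triangular cubic multigraph, distinct neighbours of a vertex are adjacent. -/
lemma Triangular.adj_trans (htri : Triangular m) (hsymm : ∀ i j, m i j = m j i)
    (hdiag : ∀ i, m i i = 0) (hdeg : ∀ i, ∑ j, m i j = 3) {i j k : Fin n} (hjk : j ≠ k)
    (hij : 0 < m i j) (hik : 0 < m i k) : 0 < m j k := by
  have hone : ∀ {v a}, 0 < m v a → m v a = 1 := fun {v a} h =>
    le_antisymm (htri.le_one hsymm hdiag hdeg v a) h
  have hne : ∀ {v a}, 0 < m v a → v ≠ a := by
    rintro v _ h rfl; simp [hdiag] at h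
  have hsw : ∀ {v a}, 0 < m v a → 0 < m a v := fun {v a} h => hsymm v a ▸ h
  by_contra hadj
  obtain ⟨l, hlj, hlk, hil, hi⟩ := exists_third_neighbor hdeg hjk (hone hij) (hone hik)
  have hjl : 0 < m j l := by
    obtain ⟨e, -, hej, hie, hje⟩ := htri i j (hne hij) hij
    rcases hi e hie with rfl | rfl | rfl
    exacts [absurd rfl hej, absurd hje hadj, hje]
  have hkl : 0 < m k l := by
    obtain ⟨e, -, hek, hie, hke⟩ := htri i k (hne hik) hik
    rcases hi e hie with rfl | rfl | rfl
    exacts [absurd (hsw hke) hadj, absurd rfl hek, hke]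
  obtain ⟨k', hk'i, hk'j, hlk', hl⟩ :=
    exists_third_neighbor hdeg (hne hij) (hone (hsw hil)) (hone (hsw hjl))
  obtain rfl : k = k' := by
    rcases hl k (hsw hkl) with h | h | h
    exacts [absurd h.symm (hne hik), absurd h.symm hjk, h]
  obtain ⟨d, hdi, hdl, hjd, hj⟩ :=
    exists_third_neighbor hdeg (hne hil) (hone (hsw hij)) (hone hjl)
  have hdk : d ≠ k := by rintro rfl; exact hadj hjd
  obtain ⟨e, -, hed, hje, hde⟩ := htri j d (hne hjd) hjd
  rcases hj e hje with rfl | rfl | rfl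
  · rcases hi d (hsw hde) with h | h | h
    exacts [hne hjd h.symm, hdk h, hdl h]
  · rcases hl d (hsw hde) with h | h | h
    exacts [hdi h, hne hjd h.symm, hdk h]
  · exact hed rfl

/-- The vertex set of a triangular cubic multigraph splits into classes of four mutually
adjacent vertices. -/
lemma Triangular.four_dvd (htri : Triangular m) (hsymm : ∀ i j, m i j = m j i)
    (hdiag : ∀ i, m i i = 0) (hdeg : ∀ i, ∑ j, m i j = 3) : 4 ∣ n := by
  classical
  let s : Setoid (Fin n) :=
    { r := fun i j => i = j ∨ 0 < m i j
      iseqv :=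
        { refl := fun _ => Or.inl rfl
          symm := fun {i j} h => h.imp Eq.symm fun h => hsymm i j ▸ h
          trans := by
            rintro i j k (rfl | hij) (rfl | hjk)
            · exact Or.inl rfl
            · exact Or.inr hjk
            · exact Or.inr hij
            · by_cases hik : i = k
              · exact Or.inl hik
              · exact Or.inr (htri.adj_trans hsymm hdiag hdeg hik (hsymm i j ▸ hij) hjk) } }
  have hclass : ∀ q : Quotient s, (Finset.univ.filter fun j => Quotient.mk s j = q).card = 4 := by
    intro q
    induction q using Quotient.inductionOn with | _ i
    have heq : (Finset.univ.filter fun j => Quotient.mk s j = Quotient.mk s i)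
        = insert i (Finset.univ.filter fun j => 0 < m i j) := by
      ext j
      simp only [Finset.mem_filter, Finset.mem_univ, true_and, Finset.mem_insert, Quotient.eq]
      change (j = i ∨ 0 < m j i) ↔ _
      rw [hsymm]
    rw [heq, Finset.card_insert_of_notMem (by simp [hdiag]), Finset.card_filter]
    rw [Finset.sum_congr rfl fun j _ => ?_, hdeg i]
    have := htri.le_one hsymm hdiag hdeg i j
    split_ifs <;> omega
  have hcard := Finset.card_eq_sum_card_fiberwise (f := Quotient.mk s)
    (s := Finset.univ) (t := Finset.univ) fun _ _ => Finset.mem_coe.2 (Finset.mem_univ _)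
  simp only [hclass, Finset.card_univ, Fintype.card_fin, Finset.sum_const, smul_eq_mul] at hcard
  exact ⟨_, hcard.trans (mul_comm _ _)⟩

end Cubic

/-- A disjoint union of copies of `K₄` is a triangular cubic multigraph. -/
lemma exists_triangular_cubic (k : ℕ) :
    ∃ m : Fin (k * 4) → Fin (k * 4) → ℕ,
      (∀ i j, m i j = m j i) ∧ (∀ i, m i i = 0) ∧ Triangular m ∧ ∀ i, ∑ j, m i j = 3 := by
  let e : Fin (k * 4) ≃ Fin k × Fin 4 := finProdFinEquiv.symm
  refine ⟨fun i j => if (e i).1 = (e j).1 then if (e i).2 = (e j).2 then 0 else 1 else 0,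
    fun i j => by simp only [eq_comm], fun i => by simp, ?_, fun i => ?_⟩
  · intro i j _ h
    have hfst : (e i).1 = (e j).1 := by by_contra hne; simp [hne] at h
    obtain ⟨c, hci, hcj⟩ : ∃ c : Fin 4, c ≠ (e i).2 ∧ c ≠ (e j).2 := by
      generalize (e i).2 = a
      generalize (e j).2 = b
      revert a b
      decide
    refine ⟨e.symm ((e i).1, c), ?_, ?_, ?_, ?_⟩
    · exact fun h => hci (by rw [← h, Equiv.apply_symm_apply])
    · exact fun h => hcj (by rw [← h, Equiv.apply_symm_apply])
    · simp [hci.symm]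
    · simp [hcj.symm, hfst]
  · rw [e.sum_comp fun p => if (e i).1 = p.1 then if (e i).2 = p.2 then 0 else 1 else 0,
      Fintype.sum_prod_type_right]
    simp only [Finset.sum_ite_eq, Finset.mem_univ, if_true]
    have hfour : ∀ a : Fin 4, (∑ b, if a = b then 0 else 1) = 3 := by decide
    exact hfour _

theorem stmt_2 (n : ℕ) (hn : 0 < n) :
    (∃ m : Fin n → Fin n → ℕ,
      (∀ i j : Fin n, m i j = m j i) ∧
      (∀ i : Fin n, m i i = 0) ∧
      Triangular m ∧
      (∀ i : Fin n, ∑ j, m i j = 3)) ↔ 4 ∣ n := by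
  constructor
  · rintro ⟨m, hsymm, hdiag, htri, hdeg⟩
    exact htri.four_dvd hsymm hdiag hdeg
  · rintro ⟨k, rfl⟩
    rw [mul_comm]
    exact exists_triangular_cubic k
end

section
/- If there exists a triangular multigraph on n vertices in which every vertex has degree 3, then n is divisible by 4. -/
/-- If the values of `f` on `s` do not exhaust its total, then `f` is positive off `s`. -/
theorem exists_notMem_pos_of_sum_lt {ι : Type*} [Fintype ι] {f : ι → ℕ} (s : Finset ι)
    (h : ∑ j ∈ s, f j < ∑ j, f j) : ∃ j, j ∉ s ∧ 0 < f j := by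
  by_contra! hc
  exact h.ne (Finset.sum_subset s.subset_univ fun j _ hj => Nat.le_zero.mp (hc j hj))

theorem add_three_le_sum {ι : Type*} [Fintype ι] [DecidableEq ι] (f : ι → ℕ) {x y z : ι}
    (hxy : x ≠ y) (hxz : x ≠ z) (hyz : y ≠ z) : f x + f y + f z ≤ ∑ j, f j := by
  have h := Finset.sum_le_univ_sum_of_nonneg (f := f) (s := {x, y, z}) fun _ => Nat.zero_le _
  rw [Finset.sum_insert (by simp [hxy, hxz]), Finset.sum_pair hyz] at h
  omega

theorem add_four_le_sum {ι : Type*} [Fintype ι] [DecidableEq ι] (f : ι → ℕ) {x y z w : ι}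
    (hxy : x ≠ y) (hxz : x ≠ z) (hxw : x ≠ w) (hyz : y ≠ z) (hyw : y ≠ w) (hzw : z ≠ w) :
    f x + f y + f z + f w ≤ ∑ j, f j := by
  have h := Finset.sum_le_univ_sum_of_nonneg (f := f) (s := {x, y, z, w}) fun _ => Nat.zero_le _
  rw [Finset.sum_insert (by simp [hxy, hxz, hxw]), Finset.sum_insert (by simp [hyz, hyw]),
    Finset.sum_pair hzw] at h
  omega

section Cubic

variable {n : ℕ} {m : Fin n → Fin n → ℕ}

theorem ne_of_mult_pos (hloop : ∀ i, m i i = 0) {a b : Fin n} (h : 0 < m a b) : a ≠ b := by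
  rintro rfl
  simp [hloop] at h

/-- A vertex of degree 3 has at most three neighbours. -/
theorem eq_of_mult_pos (hdeg : ∀ i, ∑ j, m i j = 3) {a x y z w : Fin n}
    (hxy : x ≠ y) (hxz : x ≠ z) (hyz : y ≠ z)
    (hx : 0 < m a x) (hy : 0 < m a y) (hz : 0 < m a z) (hw : 0 < m a w) :
    w = x ∨ w = y ∨ w = z := by
  by_contra! hne
  have := add_four_le_sum (m a) hxy hxz hne.1.symm hyz hne.2.1.symm hne.2.2.symm
  have := hdeg a
  omega

/-- A triangular multigraph of constant degree 3 has no multiple edges. -/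
theorem Triangular.mult_le_one (htri : Triangular m) (hsymm : ∀ i j, m i j = m j i)
    (hloop : ∀ i, m i i = 0) (hdeg : ∀ i, ∑ j, m i j = 3) (a b : Fin n) : m a b ≤ 1 := by
  by_contra! hab
  have hne := ne_of_mult_pos hloop (by omega : 0 < m a b)
  obtain ⟨c, hca, hcb, hac, hbc⟩ := htri a b hne (by omega)
  have full_a : ∀ d, d ≠ b → d ≠ c → m a d = 0 := fun d hb hc => by
    have := add_three_le_sum (m a) hcb.symm hb.symm hc.symm
    have := hdeg a
    omega
  have full_b : ∀ d, d ≠ a → d ≠ c → m b d = 0 := fun d ha hc => by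
    have := add_three_le_sum (m b) hca.symm ha.symm hc.symm
    have := hdeg b
    have := hsymm a b
    omega
  have hca1 : m c a ≤ 1 := by
    have h := Finset.add_le_sum (f := m a) (fun _ _ => Nat.zero_le _)
      (Finset.mem_univ b) (Finset.mem_univ c) hcb.symm
    rw [hdeg] at h
    rw [hsymm]
    omega
  have hcb1 : m c b ≤ 1 := by
    have h := Finset.add_le_sum (f := m b) (fun _ _ => Nat.zero_le _)
      (Finset.mem_univ a) (Finset.mem_univ c) hca.symm
    rw [hdeg, hsymm b a] at h
    rw [hsymm]
    omega
  obtain ⟨d, hd, hcd⟩ := exists_notMem_pos_of_sum_lt (f := m c) {a, b} (by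
    rw [hdeg, Finset.sum_pair hne]
    omega)
  simp only [Finset.mem_insert, Finset.mem_singleton, not_or] at hd
  have hne_cd := ne_of_mult_pos hloop hcd
  obtain ⟨e, hec, hed, hce, hde⟩ := htri c d hne_cd hcd
  rw [hsymm] at hac hbc hde
  rcases eq_of_mult_pos hdeg hne (Ne.symm hd.1) (Ne.symm hd.2) hac hbc hcd hce with h | h | h
  · have := full_a d hd.2 hne_cd.symm
    subst h
    omega
  · have := full_b d hd.1 hne_cd.symm
    subst h
    omega
  · exact hed h

/-- In a triangular multigraph of constant degree 3, adjacency is transitive on distinct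
vertices. -/
theorem Triangular.mult_pos_trans (htri : Triangular m) (hsymm : ∀ i j, m i j = m j i)
    (hloop : ∀ i, m i i = 0) (hdeg : ∀ i, ∑ j, m i j = 3) {a b c : Fin n}
    (hac : a ≠ c) (hab : 0 < m a b) (hbc : 0 < m b c) : 0 < m a c := by
  by_contra hnot
  have hsimple := htri.mult_le_one hsymm hloop hdeg
  have hne_ab := ne_of_mult_pos hloop hab
  have hne_bc := ne_of_mult_pos hloop hbc
  have hba : 0 < m b a := hsymm a b ▸ hab
  obtain ⟨x, hxa, hxb, hax, hbx⟩ := htri a b hne_ab hab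
  obtain ⟨y, hyb, hyc, hby, hcy⟩ := htri b c hne_bc hbc
  have hxc : x ≠ c := by
    rintro rfl
    exact hnot hax
  have hyx : y = x := by
    rcases eq_of_mult_pos hdeg hac hxa.symm hxc.symm hba hbc hbx hby with h | h | h
    · subst h
      rw [hsymm] at hcy
      exact absurd hcy hnot
    · exact absurd h hyc
    · exact h
  subst hyx
  obtain ⟨z, hz, haz⟩ := exists_notMem_pos_of_sum_lt (f := m a) {b, y} (by
    rw [hdeg, Finset.sum_pair hyb.symm]
    have := hsimple a b
    have := hsimple a y
    omega)
  simp only [Finset.mem_insert, Finset.mem_singleton, not_or] at hz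
  have hne_az := ne_of_mult_pos hloop haz
  have hzc : z ≠ c := by
    rintro rfl
    exact hnot haz
  obtain ⟨w, hwa, hwz, haw, hzw⟩ := htri a z hne_az haz
  rw [hsymm] at hzw hax hcy
  have hyb' : 0 < m y b := hsymm b y ▸ hby
  rcases eq_of_mult_pos hdeg hyb.symm (Ne.symm hz.1) (Ne.symm hz.2) hab
    (hsymm y a ▸ hax) haz haw with h | h | h
  · subst h
    rcases eq_of_mult_pos hdeg hac hxa.symm hxc.symm hba hbc hby hzw with h | h | h
    · exact hne_az h.symm
    · exact hzc h
    · exact hz.2 h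
  · subst h
    rcases eq_of_mult_pos hdeg hne_ab hac hne_bc hax hyb' hcy hzw with h | h | h
    · exact hne_az h.symm
    · exact hz.1 h
    · exact hzc h
  · exact hwz h

end Cubic

theorem stmt_3 (n : ℕ) (m : Fin n → Fin n → ℕ)
    (hsymm : ∀ i j : Fin n, m i j = m j i)
    (hloop : ∀ i : Fin n, m i i = 0)
    (htri : Triangular m)
    (hdeg : ∀ i : Fin n, ∑ j, m i j = 3) :
    4 ∣ n := by
  have hsimple := htri.mult_le_one hsymm hloop hdeg
  have htrans : ∀ {a b c}, a ≠ c → 0 < m a b → 0 < m b c → 0 < m a c :=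
    htri.mult_pos_trans hsymm hloop hdeg
  let N : Fin n → Finset (Fin n) := fun i => insert i (Finset.univ.filter fun j => 0 < m i j)
  have mem_N : ∀ i j, j ∈ N i ↔ j = i ∨ 0 < m i j := by simp [N]
  have card_N : ∀ i, (N i).card = 4 := fun i => by
    rw [Finset.card_insert_of_notMem (by simp [hloop]), Finset.card_filter]
    refine congrArg (· + 1) (Eq.trans ?_ (hdeg i))
    refine Finset.sum_congr rfl fun j _ => ?_
    have := hsimple i j
    split_ifs <;> omega
  have N_eq : ∀ i j, N j = N i ↔ j ∈ N i := fun i j => by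
    constructor
    · intro h
      exact h ▸ (mem_N j j).mpr (Or.inl rfl)
    · intro h
      ext k
      rw [mem_N] at h
      rw [mem_N, mem_N]
      grind
  rw [← Fintype.card_fin n, ← Finset.card_univ, Finset.card_eq_sum_card_image N]
  refine Finset.dvd_sum fun s hs => ?_
  obtain ⟨i, -, rfl⟩ := Finset.mem_image.mp hs
  simp only [N_eq, Finset.filter_univ_mem, card_N, dvd_refl]
end

section
/- Let G be a triangular multigraph on n vertices in which every vertex has degree 3. Then every connected component of G is isomorphic to K₄; precisely, for every vertex v, the set of vertices reachable from v in the adjacency graph of G has exactly 4 elements, and m(u, w) = 1 for every pair of distinct vertices u, w in that set. -/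
section CubicTriangular

variable {n : ℕ} {m : Fin n → Fin n → ℕ}

lemma sum_four_le (hdeg : ∀ i : Fin n, ∑ j, m i j = 3) (x a b c d : Fin n)
    (hab : a ≠ b) (hac : a ≠ c) (had : a ≠ d) (hbc : b ≠ c) (hbd : b ≠ d) (hcd : c ≠ d) :
    m x a + m x b + m x c + m x d ≤ 3 := by
  have h := Finset.sum_le_sum_of_subset (f := m x) (Finset.subset_univ {a, b, c, d})
  rw [hdeg, Finset.sum_insert (by simp [*]), Finset.sum_insert (by simp [*]),
    Finset.sum_pair hcd] at h
  omega

lemma sum_three_le (hdeg : ∀ i : Fin n, ∑ j, m i j = 3) (x a b c : Fin n)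
    (hab : a ≠ b) (hac : a ≠ c) (hbc : b ≠ c) : m x a + m x b + m x c ≤ 3 := by
  have h := Finset.sum_le_sum_of_subset (f := m x) (Finset.subset_univ {a, b, c})
  rw [hdeg, Finset.sum_insert (by simp [*]), Finset.sum_pair hbc] at h
  omega

lemma exists_other_neighbor (hdeg : ∀ i : Fin n, ∑ j, m i j = 3) (x a b : Fin n)
    (hab : a ≠ b) (h : m x a + m x b < 3) : ∃ c, c ≠ a ∧ c ≠ b ∧ 0 < m x c := by
  by_contra! hc
  have hs : ∑ j ∈ {a, b}, m x j = ∑ j, m x j :=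
    Finset.sum_subset (Finset.subset_univ _) fun c _ hcs => by
      simp only [Finset.mem_insert, Finset.mem_singleton, not_or] at hcs
      exact Nat.le_zero.mp (hc c hcs.1 hcs.2)
  rw [hdeg, Finset.sum_pair hab] at hs
  omega

lemma exists_neighbor (hdeg : ∀ i : Fin n, ∑ j, m i j = 3) (x : Fin n) : ∃ a, 0 < m x a := by
  by_contra! h
  have hs := hdeg x
  rw [Finset.sum_eq_zero fun a _ => Nat.le_zero.mp (h a)] at hs
  omega

lemma multiplicity_le_one (hsymm : ∀ i j : Fin n, m i j = m j i) (hloop : ∀ i : Fin n, m i i = 0)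
    (htri : Triangular m) (hdeg : ∀ i : Fin n, ∑ j, m i j = 3) (v a : Fin n) : m v a ≤ 1 := by
  by_contra! h
  have hva : v ≠ a := by rintro rfl; simp [hloop] at h
  obtain ⟨k, hkv, hka, hvk, hak⟩ := htri v a hva (by omega)
  have hsv := hsymm v k
  have hsa := hsymm a k
  have hsva := hsymm v a
  have hv : ∀ x, x ≠ a → x ≠ k → m v x = 0 := fun x h1 h2 => by
    have := sum_three_le hdeg v a k x hka.symm h1.symm h2.symm
    omega
  have ha : ∀ x, x ≠ v → x ≠ k → m a x = 0 := fun x h1 h2 => by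
    have := sum_three_le hdeg a v k x hkv.symm h1.symm h2.symm
    omega
  have h1 := sum_three_le hdeg v v a k hva hkv.symm hka.symm
  have h2 := sum_three_le hdeg a v a k hva hkv.symm hka.symm
  obtain ⟨c, hcv, hca, hkc⟩ := exists_other_neighbor hdeg k v a hva (by omega)
  have hck : c ≠ k := by rintro rfl; simp [hloop] at hkc
  obtain ⟨e, hek, hec, hke, hce⟩ := htri k c hck.symm hkc
  have hev : e ≠ v := by
    rintro rfl
    rw [hsymm, hv c hca hck] at hce
    omega
  have hea : e ≠ a := by
    rintro rfl
    rw [hsymm, ha c hcv hck] at hce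
    omega
  have := sum_four_le hdeg k v a c e hva hcv.symm hev.symm hca.symm hea.symm hec.symm
  omega

/-- If two triangles share the edge `v a`, their other two vertices are adjacent. -/
lemma adjacent_of_common_edge (hsymm : ∀ i j : Fin n, m i j = m j i)
    (hloop : ∀ i : Fin n, m i i = 0) (htri : Triangular m) (hdeg : ∀ i : Fin n, ∑ j, m i j = 3)
    (v a b c : Fin n) (hva : v ≠ a) (hvb : v ≠ b) (hvc : v ≠ c) (hab : a ≠ b) (hac : a ≠ c)
    (hbc : b ≠ c) (mva : 0 < m v a) (mvb : 0 < m v b) (mvc : 0 < m v c) (mab : 0 < m a b)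
    (mac : 0 < m a c) : 0 < m b c := by
  have hle := multiplicity_le_one hsymm hloop htri hdeg
  have := hsymm v a
  have := hsymm v b
  have := hsymm a b
  obtain ⟨d, hdv, hda, hbd⟩ := exists_other_neighbor hdeg b v a hva
    (by have := hle b v; have := hle b a; omega)
  by_cases hdc : d = c
  · exact hdc ▸ hbd
  have hdb : d ≠ b := by rintro rfl; simp [hloop] at hbd
  obtain ⟨e, heb, hed, hbe, hde⟩ := htri b d hdb.symm hbd
  have hev : e ≠ v := by
    rintro rfl
    have := sum_four_le hdeg e a b c d hab hac hda.symm hbc hdb.symm (Ne.symm hdc)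
    have := hsymm e d
    omega
  have hea : e ≠ a := by
    rintro rfl
    have := sum_four_le hdeg e v b c d hvb hvc hdv.symm hbc hdb.symm (Ne.symm hdc)
    have := hsymm e d
    omega
  have := sum_four_le hdeg b v a d e hva hdv.symm hev.symm hda.symm hea.symm hed.symm
  omega

lemma exists_complete_four (hsymm : ∀ i j : Fin n, m i j = m j i)
    (hloop : ∀ i : Fin n, m i i = 0) (htri : Triangular m) (hdeg : ∀ i : Fin n, ∑ j, m i j = 3)
    (v : Fin n) : ∃ S : Finset (Fin n), v ∈ S ∧ S.card = 4 ∧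
      ∀ u ∈ S, ∀ w ∈ S, u ≠ w → 0 < m u w := by
  have hle := multiplicity_le_one hsymm hloop htri hdeg
  have hne : ∀ x y, 0 < m x y → x ≠ y := by rintro x _ h rfl; simp [hloop] at h
  have key : ∀ a b c, a ≠ b → a ≠ c → b ≠ c → 0 < m v a → 0 < m v b → 0 < m v c →
      0 < m a b → 0 < m a c → ∃ S : Finset (Fin n), v ∈ S ∧ S.card = 4 ∧
        ∀ u ∈ S, ∀ w ∈ S, u ≠ w → 0 < m u w := by
    intro a b c hab hac hbc mva mvb mvc mab mac
    have hva := hne _ _ mva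
    have hvb := hne _ _ mvb
    have hvc := hne _ _ mvc
    have mbc := adjacent_of_common_edge hsymm hloop htri hdeg v a b c hva hvb hvc hab hac hbc
      mva mvb mvc mab mac
    refine ⟨{v, a, b, c}, by simp, ?_, ?_⟩
    · rw [Finset.card_insert_of_notMem (by simp [*]), Finset.card_insert_of_notMem (by simp [*]),
        Finset.card_pair hbc]
    · intro u hu w hw huw
      simp only [Finset.mem_insert, Finset.mem_singleton] at hu hw
      grind
  obtain ⟨a, mva⟩ := exists_neighbor hdeg v
  obtain ⟨b, hbv, hba, mvb, mab⟩ := htri v a (hne _ _ mva) mva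
  obtain ⟨c, hca, hcb, mvc⟩ := exists_other_neighbor hdeg v a b hba.symm
    (by have := hle v a; have := hle v b; omega)
  obtain ⟨k, hkv, hkc, mvk, mck⟩ := htri v c (hne _ _ mvc) mvc
  by_cases hka : k = a
  · subst hka
    exact key k b c hba.symm hca.symm hcb.symm mva mvb mvc mab (hsymm c k ▸ mck)
  by_cases hkb : k = b
  · subst hkb
    exact key k a c hba hcb.symm hca.symm mvb mva mvc (hsymm a k ▸ mab) (hsymm c k ▸ mck)
  have := sum_four_le hdeg v a b c k hba.symm hca.symm (Ne.symm hka) hcb.symm (Ne.symm hkb)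
    hkc.symm
  omega

end CubicTriangular

theorem stmt_5 (n : ℕ) (m : Fin n → Fin n → ℕ)
    (hsymm : ∀ i j : Fin n, m i j = m j i)
    (hloop : ∀ i : Fin n, m i i = 0)
    (htri : Triangular m)
    (hdeg : ∀ i : Fin n, ∑ j, m i j = 3) :
    ∀ v : Fin n,
      ({u : Fin n |
          Relation.ReflTransGen (fun i j : Fin n => i ≠ j ∧ 0 < m i j) v u}.ncard = 4) ∧
      (∀ u w : Fin n,
        Relation.ReflTransGen (fun i j : Fin n => i ≠ j ∧ 0 < m i j) v u →
        Relation.ReflTransGen (fun i j : Fin n => i ≠ j ∧ 0 < m i j) v w →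
        u ≠ w → m u w = 1) := by
  intro v
  obtain ⟨S, hvS, hcard, hS⟩ := exists_complete_four hsymm hloop htri hdeg v
  have closed : ∀ u ∈ S, ∀ w, u ≠ w → 0 < m u w → w ∈ S := by
    intro u hu w huw hm
    by_contra hw
    have h3 : 3 ≤ ∑ j ∈ S.erase u, m u j := by
      have := Finset.card_nsmul_le_sum (S.erase u) (m u) 1 fun j hj =>
        hS u hu j (Finset.mem_of_mem_erase hj) (Finset.ne_of_mem_erase hj).symm
      rw [Finset.card_erase_of_mem hu, hcard] at this
      simpa using this
    have hsum := Finset.sum_le_sum_of_subset (f := m u)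
      (Finset.subset_univ (insert w (S.erase u)))
    rw [hdeg, Finset.sum_insert fun h => hw (Finset.mem_of_mem_erase h)] at hsum
    omega
  have reach : ∀ u, Relation.ReflTransGen (fun i j : Fin n => i ≠ j ∧ 0 < m i j) v u ↔ u ∈ S := by
    refine fun u => ⟨fun h => ?_, fun hu => ?_⟩
    · induction h with
      | refl => exact hvS
      | tail _ hstep ih => exact closed _ ih _ hstep.1 hstep.2
    · by_cases huv : v = u
      · exact huv ▸ .refl
      · exact .single ⟨huv, hS v hvS u hu huv⟩
  refine ⟨?_, fun u w hu hw huw => ?_⟩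
  · simp only [reach]
    rw [← hcard]
    exact Set.ncard_coe_finset S
  · exact le_antisymm (multiplicity_le_one hsymm hloop htri hdeg u w)
      (hS u ((reach u).mp hu) w ((reach w).mp hw) huw)
end

section
/- Let n ≥ 3 and let (d₁,…,dₙ) be a sequence of non-negative integers satisfying (i) d₂ ≥ d₃ ≥ ⋯ ≥ dₙ ≥ 4 (no constraint relating d₁ to the other terms beyond the following), (ii) d₁ + ⋯ + dₙ is even, (iii) d₁ ≤ Σ_{i=2}^{n} (dᵢ − 1), and (iv) the alternating sum D = Σ_{i=1}^{n} (−1)^{i−1} dᵢ satisfies D ≥ n − 2 (as integers). Then there exists a triangular multigraph on n vertices v₁,…,vₙ with deg(vᵢ) = dᵢ for all i ∈ [n]. -/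
open Finset

/-- A subsequence of total `s` can be carved out of any sequence of total at least `s`. -/
theorem exists_le_sum_eq {ι : Type*} [Fintype ι] [DecidableEq ι] (u : ι → ℕ) (s : ℕ)
    (hs : s ≤ ∑ i, u i) : ∃ e : ι → ℕ, (∀ i, e i ≤ u i) ∧ ∑ i, e i = s := by
  induction s with
  | zero => exact ⟨fun _ => 0, by simp, by simp⟩
  | succ s ih =>
    obtain ⟨e, he, hsum⟩ := ih (by omega)
    obtain ⟨i, -, hi⟩ : ∃ i ∈ univ, e i < u i := by
      apply exists_lt_of_sum_lt
      omega
    refine ⟨fun j => e j + if j = i then 1 else 0, fun j => ?_, ?_⟩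
    · have := he j
      dsimp only
      split_ifs with h
      · subst h; omega
      · omega
    · rw [sum_add_distrib, hsum]
      simp

/-- A sequence with even total in which no term exceeds half of the total is the degree sequence
of a loopless multigraph. -/
theorem exists_multigraph_of_two_mul_le_sum {ι : Type*} [Fintype ι] [DecidableEq ι] (t : ℕ)
    (e : ι → ℕ) (hsum : ∑ i, e i = 2 * t) (hle : ∀ i, e i ≤ t) :
    ∃ m : ι → ι → ℕ, (∀ i j, m i j = m j i) ∧ (∀ i, m i i = 0) ∧ ∀ i, ∑ j, m i j = e i := by
  induction t generalizing e with
  | zero =>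
    exact ⟨fun _ _ => 0, fun _ _ => rfl, fun _ => rfl, fun i => by have := hle i; simp; omega⟩
  | succ t ih =>
    have hne : (univ : Finset ι).Nonempty := by
      by_contra h
      rw [not_nonempty_iff_eq_empty] at h
      simp [h] at hsum
    obtain ⟨a, -, ha⟩ := exists_max_image univ e hne
    have hsplit := add_sum_erase univ e (mem_univ a)
    have hne' : (univ.erase a).Nonempty := by
      by_contra h
      rw [not_nonempty_iff_eq_empty] at h
      rw [h, sum_empty] at hsplit
      have := hle a
      omega
    obtain ⟨b, hb, hbmax⟩ := exists_max_image (univ.erase a) e hne'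
    have hba : b ≠ a := ne_of_mem_erase hb
    have hbpos : 0 < e b := by
      by_contra h
      have hz : ∑ x ∈ univ.erase a, e x = 0 :=
        sum_eq_zero fun x hx => by have := hbmax x hx; omega
      have := hle a
      omega
    have hab := ha b (mem_univ b)
    let e' : ι → ℕ := fun i => e i - if i = a ∨ i = b then 1 else 0
    have he' : ∀ i, e i = e' i + ((if i = a then 1 else 0) + if i = b then 1 else 0) := by
      intro i
      simp only [e']
      by_cases h1 : i = a
      · subst h1; simp [hba.symm]; omega
      · by_cases h2 : i = b
        · subst h2; simp [hba]; omega
        · simp [h1, h2]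
    have hsum' : ∑ i, e' i = 2 * t := by
      have : ∑ i, e i = ∑ i, e' i + 2 := by
        rw [sum_congr rfl fun i _ => he' i, sum_add_distrib, sum_add_distrib]
        simp
      omega
    have hle' : ∀ i, e' i ≤ t := by
      intro i
      have hi := hle i
      have hei := he' i
      by_cases h1 : i = a
      · simp only [h1, if_true] at *; omega
      by_cases h2 : i = b
      · simp only [h2, if_true] at *; omega
      have hib := hbmax i (mem_erase.2 ⟨h1, mem_univ i⟩)
      have hsplit' := add_sum_erase _ e hb
      have hi' := single_le_sum (f := e) (fun _ _ => Nat.zero_le _)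
        (mem_erase.2 ⟨h2, mem_erase.2 ⟨h1, mem_univ i⟩⟩)
      simp only [h1, h2, if_false] at hei
      omega
    obtain ⟨m, hsymm, hdiag, hdeg⟩ := ih e' hsum' hle'
    refine ⟨fun i j => m i j + ((if i = a then (if j = b then 1 else 0) else 0) +
      if i = b then (if j = a then 1 else 0) else 0), fun i j => ?_, fun i => ?_, fun i => ?_⟩
    · dsimp only
      rw [hsymm i j]
      split_ifs <;> simp
    · dsimp only
      rw [hdiag i]
      split_ifs <;> simp_all
    · rw [sum_add_distrib, hdeg i, sum_add_distrib, he' i]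
      split_ifs <;> simp

theorem alternating_sum_range_two_mul_nonneg (g : ℕ → ℤ) (l : ℕ)
    (hanti : ∀ i j, i ≤ j → j < 2 * l → g j ≤ g i) :
    0 ≤ ∑ i ∈ range (2 * l), (-1 : ℤ) ^ i * g i := by
  induction l with
  | zero => simp
  | succ l ih =>
    have h1 := ih fun i j h h' => hanti i j h (by omega)
    have h2 := hanti (2 * l) (2 * l + 1) (by omega) (by omega)
    rw [Nat.mul_succ, sum_range_succ, sum_range_succ, pow_succ, (even_two_mul l).neg_one_pow]
    linarith

theorem mod_two_le_alternating_sum (g : ℕ → ℤ) (N : ℕ)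
    (hanti : ∀ i j, i ≤ j → j < N → g j ≤ g i) (hpos : ∀ i < N, 1 ≤ g i) :
    ((N % 2 : ℕ) : ℤ) ≤ ∑ i ∈ range N, (-1 : ℤ) ^ i * g i := by
  obtain ⟨l, rfl | rfl⟩ := Nat.even_or_odd' N
  · simpa using alternating_sum_range_two_mul_nonneg g l hanti
  · have h1 := alternating_sum_range_two_mul_nonneg g l fun i j h h' => hanti i j h (by omega)
    have h2 := hpos (2 * l) (by omega)
    rw [sum_range_succ, (even_two_mul l).neg_one_pow, Nat.mul_add_mod]
    norm_num
    linarith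

theorem le_alternating_sum_add_sum (g : ℕ → ℤ) (N : ℕ) (h2 : 2 ≤ N) (h4 : ∀ i < N, 4 ≤ g i) :
    (N : ℤ) - 2 + ((N % 2 : ℕ) : ℤ) + 2 * g 0 ≤
      ∑ i ∈ range N, (-1 : ℤ) ^ i * g i + ∑ i ∈ range N, g i := by
  induction N using Nat.twoStepInduction with
  | zero => omega
  | one => omega
  | more k ih _ =>
    rw [Nat.add_mod_right]
    have hk0 := h4 k (by omega)
    have hk1 := h4 (k + 1) (by omega)
    match k, ih with
    | 0, _ => simp [sum_range_succ]; linarith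
    | 1, _ => simp [sum_range_succ] at *; linarith [h4 2 (by omega)]
    | k + 2, ih =>
      have h1 := ih (by omega) (fun i h => h4 i (by omega))
      rw [sum_range_succ, sum_range_succ, sum_range_succ g, sum_range_succ g, pow_succ _ (k + 2)]
      push_cast at *
      rcases neg_one_pow_eq_or ℤ (k + 2) with h | h <;> rw [h] <;> linarith

/-- A cone over a multigraph without isolated vertices is triangular. -/
theorem exists_triangular_cone {N : ℕ} (x e : Fin N → ℕ) (m : Fin N → Fin N → ℕ)
    (hx : ∀ i, 0 < x i) (he : ∀ i, 1 ≤ e i) (hsymm : ∀ i j, m i j = m j i)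
    (hdiag : ∀ i, m i i = 0) (hdeg : ∀ i, ∑ j, m i j = e i) :
    ∃ M : Fin (N + 1) → Fin (N + 1) → ℕ, (∀ i j, M i j = M j i) ∧ (∀ i, M i i = 0) ∧
      Triangular M ∧ ∑ j, M 0 j = ∑ i, x i ∧ ∀ i, ∑ j, M (Fin.succ i) j = x i + e i := by
  let M : Fin (N + 1) → Fin (N + 1) → ℕ :=
    Fin.cons (Fin.cons 0 x) fun i => Fin.cons (x i) (m i)
  have hnbr : ∀ i, ∃ k, k ≠ i ∧ 0 < m i k := by
    intro i
    obtain ⟨k, -, hk⟩ : ∃ k ∈ univ, 0 < m i k := by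
      by_contra! h
      have := sum_nonpos h
      have := he i
      have := hdeg i
      omega
    exact ⟨k, fun h => by rw [h, hdiag] at hk; omega, hk⟩
  refine ⟨M, fun i j => ?_, fun i => ?_, fun i j => ?_, ?_, fun i => ?_⟩
  · cases i using Fin.cases <;> cases j using Fin.cases <;> simp [M, hsymm]
  · cases i using Fin.cases <;> simp [M, hdiag]
  · cases i using Fin.cases with
    | zero =>
      cases j using Fin.cases with
      | zero => simp
      | succ j =>
        intro _ _
        obtain ⟨k, hkj, hk⟩ := hnbr j
        exact ⟨k.succ, Fin.succ_ne_zero k, by simpa using hkj, by simpa [M] using hx k,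
          by simpa [M] using hk⟩
    | succ i =>
      cases j using Fin.cases with
      | zero =>
        intro _ _
        obtain ⟨k, hki, hk⟩ := hnbr i
        exact ⟨k.succ, by simpa using hki, Fin.succ_ne_zero k, by simpa [M] using hk,
          by simpa [M] using hx k⟩
      | succ j =>
        intro _ _
        exact ⟨0, (Fin.succ_ne_zero i).symm, (Fin.succ_ne_zero j).symm,
          by simpa [M] using hx i, by simpa [M] using hx j⟩
  · simp [M, Fin.sum_univ_succ]
  · simp [M, Fin.sum_univ_succ, hdeg]

/-- Criterion for truncating a sequence at half of the total that remains after paying `c`. -/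
theorem two_mul_le_sum_min_s6 {ι : Type*} [Fintype ι] [DecidableEq ι] (f : ι → ℕ) (c t : ℕ)
    (hf : ∀ i, 1 ≤ f i) (hc : Fintype.card ι ≤ c) (ht : ∑ i, f i = c + 2 * t)
    (hbig : ∀ i, 2 * (Fintype.card ι - 1) + 2 * f i ≤ c + ∑ j, f j) :
    2 * t ≤ ∑ i, min (f i - 1) t := by
  have hsub : ∀ s : Finset ι, ∑ i ∈ s, (f i - 1) + #s = ∑ i ∈ s, f i := by
    intro s
    rw [card_eq_sum_ones, ← sum_add_distrib]
    exact sum_congr rfl fun i _ => Nat.sub_add_cancel (hf i)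
  by_cases h1 : ∃ i, t < f i - 1
  · obtain ⟨i, hi⟩ := h1
    rw [← add_sum_erase univ _ (mem_univ i), min_eq_right hi.le]
    by_cases h2 : ∃ j ∈ univ.erase i, t < f j - 1
    · obtain ⟨j, hj, hjt⟩ := h2
      have := single_le_sum (f := fun i => min (f i - 1) t) (fun _ _ => Nat.zero_le _) hj
      simp only [min_eq_right hjt.le] at this
      omega
    · push Not at h2
      rw [sum_congr rfl fun j hj => min_eq_left (h2 j hj)]
      have h3 := hsub (univ.erase i)
      have h4 := add_sum_erase univ f (mem_univ i)
      have h5 := hbig i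
      rw [card_erase_of_mem (mem_univ i), card_univ] at h3
      omega
  · push Not at h1
    rw [sum_congr rfl fun j _ => min_eq_left (h1 j)]
    have := hsub univ
    rw [card_univ] at this
    omega

theorem stmt_6 (n : ℕ) (hn : 3 ≤ n) (d : Fin n → ℕ)
    (hanti : ∀ i j : Fin n, 1 ≤ (i : ℕ) → i ≤ j → d j ≤ d i)
    (h4 : ∀ i : Fin n, 1 ≤ (i : ℕ) → 4 ≤ d i)
    (heven : Even (∑ i, d i))
    (hd1 : d ⟨0, by omega⟩ ≤ ∑ i ∈ Finset.univ.erase (⟨0, by omega⟩ : Fin n), (d i - 1))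
    (hD : (n : ℤ) - 2 ≤ ∑ i : Fin n, (-1 : ℤ) ^ (i : ℕ) * (d i : ℤ)) :
    ∃ m : Fin n → Fin n → ℕ,
      (∀ i j : Fin n, m i j = m j i) ∧
      (∀ i : Fin n, m i i = 0) ∧
      Triangular m ∧
      (∀ i : Fin n, ∑ j, m i j = d i) := by
  obtain ⟨N, rfl⟩ : ∃ N, n = N + 1 := ⟨n - 1, by omega⟩
  let f : Fin N → ℕ := fun i => d i.succ
  have hf4 : ∀ i, 4 ≤ f i := fun i => h4 i.succ (by simp)
  have hfanti : ∀ i j : Fin N, i ≤ j → f j ≤ f i := fun i j h =>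
    hanti i.succ j.succ (by simp) (by simpa using h)
  have hcap : d 0 + N ≤ ∑ i, f i := by
    have h1 := add_sum_erase univ (fun i => d i - 1) (mem_univ (0 : Fin (N + 1)))
    rw [Fin.sum_univ_succ] at h1
    have h2 : ∑ i : Fin N, (d i.succ - 1) + N = ∑ i, f i := by
      have : ∑ i, f i = ∑ i : Fin N, ((d i.succ - 1) + 1) :=
        sum_congr rfl fun i _ => by have := hf4 i; simp only [f] at *; omega
      rw [this, sum_add_distrib]
      simp
    have h3 : d 0 ≤ ∑ i ∈ univ.erase (0 : Fin (N + 1)), (d i - 1) := hd1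
    omega
  obtain ⟨t, ht⟩ : ∃ t, ∑ i, f i = d 0 + 2 * t := by
    rw [Fin.sum_univ_succ] at heven
    obtain ⟨r, hr⟩ := heven
    change d 0 + ∑ i, f i = r + r at hr
    exact ⟨r - d 0, by omega⟩
  let g : ℕ → ℤ := fun i => if h : i < N then (f ⟨i, h⟩ : ℤ) else 0
  have hg : ∀ i : Fin N, g i = f i := fun i => by simp [g]
  have hgsum : ∑ i ∈ range N, g i = ((∑ i, f i : ℕ) : ℤ) := by
    rw [← Fin.sum_univ_eq_sum_range]
    push_cast
    exact sum_congr rfl fun i _ => hg i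
  have hg4 : ∀ i < N, 4 ≤ g i := fun i h => by
    rw [hg ⟨i, h⟩]
    exact_mod_cast hf4 _
  have hA1 := mod_two_le_alternating_sum g N
    (fun i j h h' => by
      rw [hg ⟨j, h'⟩, hg ⟨i, by omega⟩]
      exact_mod_cast hfanti _ _ h)
    (fun i h => by linarith [hg4 i h])
  have hA2 := le_alternating_sum_add_sum g N (by omega) hg4
  have hDg : (N : ℤ) - 1 ≤ d 0 - ∑ i ∈ range N, (-1 : ℤ) ^ i * g i := by
    rw [← Fin.sum_univ_eq_sum_range (fun i => (-1 : ℤ) ^ i * g i)]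
    rw [Fin.sum_univ_succ] at hD
    simp only [hg, f, Fin.val_succ, pow_succ, Fin.val_zero, pow_zero, one_mul, mul_neg, mul_one,
      neg_mul, sum_neg_distrib] at hD ⊢
    push_cast at hD
    linarith
  have hpar : (2 : ℤ) ∣ ∑ i ∈ range N, (-1 : ℤ) ^ i * g i + ∑ i ∈ range N, g i := by
    rw [← sum_add_distrib]
    refine dvd_sum fun i _ => ?_
    rcases neg_one_pow_eq_or ℤ i with h | h <;> rw [h]
    · exact ⟨g i, by ring⟩
    · exact ⟨0, by ring⟩
  rw [hgsum] at hA2 hpar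
  generalize ∑ i ∈ range N, (-1 : ℤ) ^ i * g i = A at hA1 hA2 hDg hpar
  have hd0 : N ≤ d 0 := by omega
  have hbig : ∀ i, 2 * (N - 1) + 2 * f i ≤ d 0 + ∑ j, f j := by
    intro i
    have h0 := hfanti ⟨0, by omega⟩ i (Nat.zero_le _)
    have h1 : g 0 = f ⟨0, by omega⟩ := hg ⟨0, by omega⟩
    omega
  have hmin := two_mul_le_sum_min_s6 f (d 0) t (fun i => by have := hf4 i; omega)
    (by simpa using hd0) ht (by simpa using hbig)
  have hmin1 : ∑ i, (min (f i - 1) t - 1) + N = ∑ i, min (f i - 1) t := by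
    have : ∑ i, min (f i - 1) t = ∑ i, ((min (f i - 1) t - 1) + 1) :=
      sum_congr rfl fun i _ => by have := hf4 i; omega
    rw [this, sum_add_distrib]
    simp
  obtain ⟨e, he, hesum⟩ :=
    exists_le_sum_eq (fun i => min (f i - 1) t - 1) (2 * t - N) (by omega)
  have hle : ∀ i, e i + 1 ≤ t ∧ e i + 2 ≤ f i := fun i => by
    have := hf4 i
    have := he i
    omega
  have hesum' : ∑ i, (e i + 1) = 2 * t := by
    rw [sum_add_distrib, hesum]
    simp
    omega
  obtain ⟨m, hsymm, hdiag, hdeg⟩ :=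
    exists_multigraph_of_two_mul_le_sum t (fun i => e i + 1) hesum' fun i => (hle i).1
  obtain ⟨M, hMsymm, hMdiag, hMtri, hM0, hM⟩ :=
    exists_triangular_cone (fun i => f i - (e i + 1)) _ m
      (fun i => by have := hle i; omega) (fun i => Nat.le_add_left 1 (e i))
      hsymm hdiag hdeg
  have hsplit : ∀ i, f i - (e i + 1) + (e i + 1) = f i := fun i =>
    Nat.sub_add_cancel (by have := hle i; omega)
  refine ⟨M, hMsymm, hMdiag, hMtri, fun i => ?_⟩
  cases i using Fin.cases with
  | zero =>
    have h1 : ∑ i, (f i - (e i + 1)) + ∑ i, (e i + 1) = ∑ i, f i := by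
      rw [← sum_add_distrib]
      exact sum_congr rfl fun i _ => hsplit i
    omega
  | succ i => rw [hM i, hsplit i]
end

section
/- Let n ≥ 3 be odd and let (d₁,…,dₙ) be a sequence of non-negative integers satisfying d₂ ≥ d₃ ≥ ⋯ ≥ dₙ ≥ 4, d₁ + ⋯ + dₙ even, d₁ ≤ Σ_{i=2}^{n} (dᵢ − 1), and alternating sum D = Σ_{i=1}^{n} (−1)^{i−1} dᵢ ≥ n − 2. Then there exists a triangular multigraph on n vertices v₁,…,vₙ with deg(vᵢ) = dᵢ for all i, in which every edge of positive multiplicity either contains v₁ or joins v_{2i} and v_{2i+1} for some 1 ≤ i ≤ (n−1)/2. -/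
/-- A sum over `0, …, 2t` splits into the term at `0` and the pairs `(2k+1, 2k+2)`. -/
theorem sum_range_odd_eq_pairs {M : Type*} [AddCommMonoid M] (f : ℕ → M) (t : ℕ) :
    ∑ i ∈ Finset.range (2 * t + 1), f i =
      f 0 + ∑ k ∈ Finset.range t, (f (2 * k + 1) + f (2 * k + 2)) := by
  induction t with
  | zero => simp
  | succ t ih =>
    rw [show 2 * (t + 1) + 1 = 2 * t + 1 + 1 + 1 by ring, Finset.sum_range_succ,
      Finset.sum_range_succ, ih, Finset.sum_range_succ]
    simp only [add_assoc]

/-- Every value up to `∑ u` is the sum of a function bounded by `u`. -/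
theorem exists_le_sum_range_eq (u : ℕ → ℕ) (t Y : ℕ) (hY : Y ≤ ∑ k ∈ Finset.range t, u k) :
    ∃ y : ℕ → ℕ, (∀ k < t, y k ≤ u k) ∧ ∑ k ∈ Finset.range t, y k = Y := by
  induction t generalizing Y with
  | zero => exact ⟨0, by simp, by simp at hY ⊢; omega⟩
  | succ t ih =>
    rw [Finset.sum_range_succ] at hY
    obtain ⟨y, hy, hs⟩ := ih (Y - min Y (u t)) (by omega)
    refine ⟨fun k => if k = t then min Y (u t) else y k, fun k hk => ?_, ?_⟩
    · by_cases h : k = t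
      · simp [h]
      · simpa [h] using hy k (by omega)
    · rw [Finset.sum_range_succ, Finset.sum_congr rfl (g := y), hs]
      · simp
      · intro k hk
        simp [(Finset.mem_range.mp hk).ne]

/-- The multigraph on `ℕ` in which `2k+1` and `2k+2` are joined by `x k` edges, and each `i ≥ 1`
is joined to `0` by the number of edges that brings its degree to `e i`. -/
def friendshipMult (e x : ℕ → ℕ) (i j : ℕ) : ℕ :=
  if i = j then 0
  else if i = 0 then e j - x ((j - 1) / 2)
  else if j = 0 then e i - x ((i - 1) / 2)
  else if (i - 1) / 2 = (j - 1) / 2 then x ((i - 1) / 2)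
  else 0

theorem friendshipMult_comm (e x : ℕ → ℕ) (i j : ℕ) :
    friendshipMult e x i j = friendshipMult e x j i := by
  unfold friendshipMult
  grind

theorem sum_friendshipMult_zero (e x : ℕ → ℕ) (t : ℕ) :
    ∑ j ∈ Finset.range (2 * t + 1), friendshipMult e x 0 j =
      ∑ k ∈ Finset.range t, ((e (2 * k + 1) - x k) + (e (2 * k + 2) - x k)) := by
  rw [sum_range_odd_eq_pairs]
  have h₁ : ∀ k, 2 * k / 2 = k := by omega
  have h₂ : ∀ k, (2 * k + 1) / 2 = k := by omega
  simp [friendshipMult, h₁, h₂]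

theorem sum_friendshipMult_of_pos (e x : ℕ → ℕ) (t i : ℕ) (hi : 0 < i) (hit : i < 2 * t + 1)
    (hx : x ((i - 1) / 2) ≤ e i) :
    ∑ j ∈ Finset.range (2 * t + 1), friendshipMult e x i j = e i := by
  rw [sum_range_odd_eq_pairs]
  have hpair : ∀ k, friendshipMult e x i (2 * k + 1) + friendshipMult e x i (2 * k + 2) =
      if (i - 1) / 2 = k then x k else 0 := by
    intro k
    have h₁ : (2 * k + 1 - 1) / 2 = k := by omega
    have h₂ : (2 * k + 2 - 1) / 2 = k := by omega
    unfold friendshipMult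
    rw [h₁, h₂]
    by_cases hk : (i - 1) / 2 = k
    · rcases (by omega : i = 2 * k + 1 ∨ i = 2 * k + 2) with rfl | rfl
      · simp
      · simp [show (2 * k + 1) / 2 = k by omega]
    · simp only [hk, if_false]
      rw [if_neg hi.ne', if_neg hi.ne']
      simp
  simp only [hpair]
  rw [Finset.sum_ite_eq, if_pos (Finset.mem_range.mpr (by omega))]
  simp only [friendshipMult, hi.ne', if_false, if_true]
  omega

theorem friendshipMult_pos_of_pair {e x : ℕ → ℕ} {i j : ℕ} (hj : 0 < j) (hij : i ≠ j)
    (h : i = 0 ∨ (i - 1) / 2 = (j - 1) / 2) (hx : 0 < x ((j - 1) / 2))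
    (hlt : x ((j - 1) / 2) < e j) : 0 < friendshipMult e x i j := by
  unfold friendshipMult
  grind

theorem eq_zero_or_pair_of_friendshipMult_pos {e x : ℕ → ℕ} {i j : ℕ}
    (h : 0 < friendshipMult e x i j) :
    i ≠ j ∧ (i = 0 ∨ j = 0 ∨ (i - 1) / 2 = (j - 1) / 2) := by
  unfold friendshipMult at h
  grind

theorem exists_common_neighbour_friendshipMult {e x : ℕ → ℕ} {t : ℕ}
    (hx : ∀ k < t, 0 < x k) (hlt : ∀ i, 0 < i → i < 2 * t + 1 → x ((i - 1) / 2) < e i)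
    {i j : ℕ} (hi : i < 2 * t + 1) (hj : j < 2 * t + 1) (h : 0 < friendshipMult e x i j) :
    ∃ k < 2 * t + 1, k ≠ i ∧ k ≠ j ∧
      0 < friendshipMult e x i k ∧ 0 < friendshipMult e x j k := by
  have pos : ∀ a b, 0 < b → b < 2 * t + 1 → a ≠ b → (a = 0 ∨ (a - 1) / 2 = (b - 1) / 2) →
      0 < friendshipMult e x a b := fun a b hb hbt hab hp =>
    friendshipMult_pos_of_pair hb hab hp (hx _ (by omega)) (hlt b hb hbt)
  have partner : ∀ b, 0 < b → b < 2 * t + 1 →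
      ∃ c, 0 < c ∧ c < 2 * t + 1 ∧ c ≠ b ∧ (b - 1) / 2 = (c - 1) / 2 := by
    intro b hb hbt
    rcases Nat.even_or_odd' b with ⟨k, rfl | rfl⟩
    · exact ⟨2 * k - 1, by omega, by omega, by omega, by omega⟩
    · exact ⟨2 * k + 2, by omega, by omega, by omega, by omega⟩
  obtain ⟨hij, hcase⟩ := eq_zero_or_pair_of_friendshipMult_pos h
  by_cases hi0 : i = 0
  · obtain ⟨c, hc, hct, hcj, hp⟩ := partner j (by omega) hj
    exact ⟨c, hct, by omega, hcj, pos i c hc hct (by omega) (Or.inl hi0),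
      pos j c hc hct hcj.symm (Or.inr hp)⟩
  by_cases hj0 : j = 0
  · obtain ⟨c, hc, hct, hci, hp⟩ := partner i (by omega) hi
    exact ⟨c, hct, hci, by omega, pos i c hc hct hci.symm (Or.inr hp),
      pos j c hc hct (by omega) (Or.inl hj0)⟩
  refine ⟨0, by omega, Ne.symm hi0, Ne.symm hj0, ?_, ?_⟩ <;> rw [friendshipMult_comm]
  · exact pos 0 i (by omega) hi (by omega) (Or.inl rfl)
  · exact pos 0 j (by omega) hj (by omega) (Or.inl rfl)

/-- The numbers `x k` of edges inside the pairs can be chosen to give vertex `0` degree `e 0`. -/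
theorem exists_pair_multiplicities (e : ℕ → ℕ) (t : ℕ)
    (hanti : ∀ k < t, e (2 * k + 2) ≤ e (2 * k + 1)) (h4 : ∀ k < t, 4 ≤ e (2 * k + 2))
    (heven : Even (∑ i ∈ Finset.range (2 * t + 1), e i))
    (hd : e 0 ≤ ∑ k ∈ Finset.range t, ((e (2 * k + 1) - 1) + (e (2 * k + 2) - 1)))
    (hD : (2 * t - 1 : ℤ) ≤ ∑ i ∈ Finset.range (2 * t + 1), (-1 : ℤ) ^ i * (e i : ℤ)) :
    ∃ x : ℕ → ℕ, (∀ k < t, 0 < x k) ∧ (∀ k < t, x k < e (2 * k + 2)) ∧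
      ∑ k ∈ Finset.range t, ((e (2 * k + 1) - x k) + (e (2 * k + 2) - x k)) = e 0 := by
  have hA : ∑ k ∈ Finset.range t, ((e (2 * k + 1) - 1) + (e (2 * k + 2) - 1)) + 2 * t =
      ∑ k ∈ Finset.range t, e (2 * k + 1) + ∑ k ∈ Finset.range t, e (2 * k + 2) := by
    rw [← Finset.sum_add_distrib, show 2 * t = ∑ k ∈ Finset.range t, 2 by simp [mul_comm],
      ← Finset.sum_add_distrib]
    refine Finset.sum_congr rfl fun k hk => ?_
    have := hanti k (Finset.mem_range.mp hk)
    have := h4 k (Finset.mem_range.mp hk)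
    omega
  have hU : ∑ k ∈ Finset.range t, (e (2 * k + 2) - 2) + 2 * t =
      ∑ k ∈ Finset.range t, e (2 * k + 2) := by
    rw [show 2 * t = ∑ k ∈ Finset.range t, 2 by simp [mul_comm], ← Finset.sum_add_distrib]
    refine Finset.sum_congr rfl fun k hk => ?_
    have := h4 k (Finset.mem_range.mp hk)
    omega
  rw [sum_range_odd_eq_pairs, Finset.sum_add_distrib] at heven hD
  have hodd : ∑ k ∈ Finset.range t, (-1 : ℤ) ^ (2 * k + 1) * (e (2 * k + 1) : ℤ) =
      -((∑ k ∈ Finset.range t, e (2 * k + 1) : ℕ) : ℤ) := by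
    simp [pow_succ, pow_mul]
  have heven' : ∑ k ∈ Finset.range t, (-1 : ℤ) ^ (2 * k + 2) * (e (2 * k + 2) : ℤ) =
      ((∑ k ∈ Finset.range t, e (2 * k + 2) : ℕ) : ℤ) := by
    simp [pow_succ, pow_mul]
  rw [hodd, heven', pow_zero, one_mul] at hD
  obtain ⟨r, hr⟩ := heven
  obtain ⟨y, hy, hs⟩ := exists_le_sum_range_eq (fun k => e (2 * k + 2) - 2) t
    (r - e 0 - t) (by omega)
  refine ⟨fun k => y k + 1, fun k _ => Nat.succ_pos _, fun k hk => ?_, ?_⟩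
  · have := hy k hk
    have := h4 k hk
    dsimp only at *
    omega
  · have hsum : ∑ k ∈ Finset.range t, ((e (2 * k + 1) - (y k + 1)) + (e (2 * k + 2) - (y k + 1))) +
        2 * ∑ k ∈ Finset.range t, y k =
        ∑ k ∈ Finset.range t, ((e (2 * k + 1) - 1) + (e (2 * k + 2) - 1)) := by
      rw [Finset.mul_sum, ← Finset.sum_add_distrib]
      refine Finset.sum_congr rfl fun k hk => ?_
      have := hy k (Finset.mem_range.mp hk)
      have := hanti k (Finset.mem_range.mp hk)
      have := h4 k (Finset.mem_range.mp hk)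
      omega
    dsimp only
    omega

theorem stmt_7 (n : ℕ) (hn : 3 ≤ n) (hodd : Odd n) (d : Fin n → ℕ)
    (hanti : ∀ i j : Fin n, 1 ≤ (i : ℕ) → i ≤ j → d j ≤ d i)
    (h4 : ∀ i : Fin n, 1 ≤ (i : ℕ) → 4 ≤ d i)
    (heven : Even (∑ i, d i))
    (hd1 : d ⟨0, by omega⟩ ≤ ∑ i ∈ Finset.univ.erase (⟨0, by omega⟩ : Fin n), (d i - 1))
    (hD : (n : ℤ) - 2 ≤ ∑ i : Fin n, (-1 : ℤ) ^ (i : ℕ) * (d i : ℤ)) :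
    ∃ m : Fin n → Fin n → ℕ,
      (∀ i j : Fin n, m i j = m j i) ∧
      (∀ i : Fin n, m i i = 0) ∧
      Triangular m ∧
      (∀ i : Fin n, ∑ j, m i j = d i) ∧
      (∀ i j : Fin n, 0 < m i j →
        i = ⟨0, by omega⟩ ∨ j = ⟨0, by omega⟩ ∨
        ∃ k : ℕ, 1 ≤ k ∧ 2 * k + 1 ≤ n ∧
          (((i : ℕ) = 2 * k - 1 ∧ (j : ℕ) = 2 * k) ∨
           ((i : ℕ) = 2 * k ∧ (j : ℕ) = 2 * k - 1))) := by
  obtain ⟨t, rfl⟩ := hodd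
  let e : ℕ → ℕ := fun i => if h : i < 2 * t + 1 then d ⟨i, h⟩ else 0
  have he : ∀ i (h : i < 2 * t + 1), e i = d ⟨i, h⟩ := fun i h => dif_pos h
  have hed : ∀ i : Fin (2 * t + 1), d i = e i := fun i => (he i i.2).symm
  have hle : ∀ k < t, e (2 * k + 2) ≤ e (2 * k + 1) := by
    intro k hk
    rw [he _ (by omega), he _ (by omega)]
    exact hanti _ _ (by simp) (by simp [Fin.le_def])
  obtain ⟨x, hx, hxe, hx0⟩ := exists_pair_multiplicities e t hle
    (fun k hk => by rw [he _ (by omega)]; exact h4 _ (by simp))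
    (by simpa only [hed, Fin.sum_univ_eq_sum_range e] using heven)
    (by
      have hsum := Finset.add_sum_erase Finset.univ (fun i : Fin (2 * t + 1) => d i - 1)
        (Finset.mem_univ ⟨0, by omega⟩)
      simp only [hed] at hsum hd1
      rw [Fin.sum_univ_eq_sum_range (fun i => e i - 1), sum_range_odd_eq_pairs] at hsum
      omega)
    (by
      simp only [hed] at hD
      rw [Fin.sum_univ_eq_sum_range (fun i => (-1 : ℤ) ^ i * (e i : ℤ))] at hD
      push_cast at hD
      linarith)
  have hlt : ∀ i, 0 < i → i < 2 * t + 1 → x ((i - 1) / 2) < e i := by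
    intro i hi hit
    have h₁ := hxe ((i - 1) / 2) (by omega)
    have h₂ := hle ((i - 1) / 2) (by omega)
    rcases (by omega : i = 2 * ((i - 1) / 2) + 1 ∨ i = 2 * ((i - 1) / 2) + 2) with h | h
    · rw [← h] at h₂
      omega
    · rwa [← h] at h₁
  refine ⟨fun i j => friendshipMult e x i j, fun i j => friendshipMult_comm e x i j,
    fun i => by simp [friendshipMult], fun i j _ h => ?_, fun i => ?_, fun i j h => ?_⟩
  · obtain ⟨k, hk, hki, hkj, h₁, h₂⟩ := exists_common_neighbour_friendshipMult hx hlt i.2 j.2 h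
    exact ⟨⟨k, hk⟩, by simpa [Fin.ext_iff] using hki, by simpa [Fin.ext_iff] using hkj, h₁, h₂⟩
  · rw [Fin.sum_univ_eq_sum_range (fun j => friendshipMult e x i j), hed]
    rcases Nat.eq_zero_or_pos (i : ℕ) with hi | hi
    · rw [hi, sum_friendshipMult_zero, hx0]
    · exact sum_friendshipMult_of_pos e x t i hi i.2 (hlt i hi i.2).le
  · obtain ⟨hij, hcase⟩ := eq_zero_or_pair_of_friendshipMult_pos h
    rcases Nat.eq_zero_or_pos (i : ℕ) with hi | hi
    · exact Or.inl (Fin.ext hi)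
    rcases Nat.eq_zero_or_pos (j : ℕ) with hj | hj
    · exact Or.inr (Or.inl (Fin.ext hj))
    exact Or.inr (Or.inr ⟨((i : ℕ) - 1) / 2 + 1, by omega, by omega, by omega⟩)
end

section
/- Let n ≥ 5 and let (d₁,…,dₙ) be a sequence of non-negative integers satisfying d₂ ≥ d₃ ≥ ⋯ ≥ dₙ ≥ 4, and such that the alternating sum D = Σ_{i=1}^{n} (−1)^{i−1} dᵢ equals 4 if n is odd, and equals one of 0, 2, 4 if n is even. Then there exists a triangular multigraph on n vertices v₁,…,vₙ with deg(vᵢ) = dᵢ for all i ∈ [n]. -/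
/-- Multiplicity of the edge `{a, b}`, `a < b`, in a modified square of the cycle `0, 1, …, n - 1`.
The parameter `s` raises the degree of `0` by `2 * s`. The excess `e` of the degrees over `4` is put
on the edges `{b, b + 1}` and `{0, b}` with `b` odd. -/
def upperMult (n s : ℕ) (e : ℕ → ℕ) (a b : ℕ) : ℕ :=
  (if b = a + 1 then 1 + (if a % 2 = 1 then e b else 0) else 0)
  + (if b = a + 2 then (if s = 2 ∧ a = 1 then 0 else 1) else 0)
  + (if a = 0 then
      (if b = n - 2 then 1 else 0) + (if b = n - 1 then (if s = 0 then 1 else 2) else 0)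
      + (if b = 1 then s else 0) + (if b = 3 then (if s = 2 then 1 else 0) else 0)
      + (if b % 2 = 1 then e b - e (b + 1) else 0) else 0)
  + (if a = 1 then (if b = n - 1 then (if s = 0 then 1 else 0) else 0) else 0)

lemma upperMult_eq_zero {n s : ℕ} (hn : 5 ≤ n) (e : ℕ → ℕ) {a b : ℕ} (h : b ≤ a) :
    upperMult n s e a b = 0 := by
  have h1 : b ≠ a + 1 := by omega
  have h2 : b ≠ a + 2 := by omega
  simp only [upperMult, if_neg h1, if_neg h2]
  grind

lemma sum_upperMult_zero {n s : ℕ} (hn : 5 ≤ n) (e : ℕ → ℕ) (hs : s ≤ 2) :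
    ∑ b ∈ Finset.range n, upperMult n s e 0 b
      = 4 + 2 * s + ∑ b ∈ Finset.range n, if b % 2 = 1 then e b - e (b + 1) else 0 := by
  simp only [upperMult, Finset.sum_add_distrib, Finset.sum_ite_eq', Finset.mem_range, if_true]
  simp
  split_ifs <;> omega

lemma sum_upperMult_right {n s : ℕ} (e : ℕ → ℕ) {a : ℕ} (ha : 1 ≤ a) :
    ∑ b ∈ Finset.range n, upperMult n s e a b
      = (if a + 1 < n then 1 + (if a % 2 = 1 then e (a + 1) else 0) else 0)
        + (if a + 2 < n then (if s = 2 ∧ a = 1 then 0 else 1) else 0)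
        + (if a = 1 ∧ n - 1 < n ∧ s = 0 then 1 else 0) := by
  have h0 : a ≠ 0 := by omega
  by_cases h1 : a = 1
  · simp only [upperMult, Finset.sum_add_distrib, Finset.sum_ite_eq', Finset.mem_range, h1]
    simp
    split_ifs <;> omega
  · simp only [upperMult, Finset.sum_add_distrib, Finset.sum_ite_eq', Finset.mem_range, h0, h1]
    simp

lemma sum_upperMult_left {n s : ℕ} (hn : 5 ≤ n) (e : ℕ → ℕ) {b : ℕ} (hb : 1 ≤ b) (hbn : b < n) :
    ∑ a ∈ Finset.range n, upperMult n s e a b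
      = (1 + (if b % 2 = 0 then e b else 0))
        + (if 2 ≤ b ∧ ¬ (s = 2 ∧ b = 3) then 1 else 0)
        + ((if b = n - 2 then 1 else 0) + (if b = n - 1 then (if s = 0 then 1 else 2) else 0)
          + (if b = 1 then s else 0) + (if b = 3 then (if s = 2 then 1 else 0) else 0)
          + (if b % 2 = 1 then e b - e (b + 1) else 0))
        + (if b = n - 1 then (if s = 0 then 1 else 0) else 0) := by
  have h1 : ∀ a, (if b = a + 1 then 1 + (if a % 2 = 1 then e b else 0) else 0)
      = if a = b - 1 then 1 + (if b % 2 = 0 then e b else 0) else 0 := by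
    intro a; split_ifs <;> omega
  have h2 : ∀ a, (if b = a + 2 then (if s = 2 ∧ a = 1 then 0 else 1) else 0)
      = if a = b - 2 then (if 2 ≤ b ∧ ¬ (s = 2 ∧ b = 3) then 1 else 0) else 0 := by
    intro a; split_ifs <;> omega
  have hb1 : b - 1 < n := by omega
  have hb2 : b - 2 < n := by omega
  have hn0 : 0 < n := by omega
  have hn1 : 1 < n := by omega
  simp only [upperMult, h1, h2, Finset.sum_add_distrib, Finset.sum_ite_eq', Finset.mem_range,
    if_pos hb1, if_pos hb2, if_pos hn0, if_pos hn1]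

lemma cases_of_upperMult_pos {n s : ℕ} {e : ℕ → ℕ} {i j : ℕ} (h : 0 < upperMult n s e i j) :
    j = i + 1 ∨ (j = i + 2 ∧ ¬ (s = 2 ∧ i = 1)) ∨ (i = 0 ∧ j = n - 2) ∨
      (i = 0 ∧ j = n - 1) ∨ (i = 0 ∧ j = 1) ∨ (i = 0 ∧ j = 3 ∧ s = 2) ∨
      (i = 0 ∧ j % 2 = 1 ∧ e (j + 1) < e j) ∨ (i = 1 ∧ j = n - 1 ∧ s = 0) := by
  contrapose! h
  obtain ⟨h1, h2, h3, h4, h5, h6, h7, h8⟩ := h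
  have t2 : (if j = i + 2 then (if s = 2 ∧ i = 1 then 0 else 1) else 0) = 0 := by
    split_ifs <;> first | rfl | tauto
  have t8 : (if i = 1 then (if j = n - 1 then (if s = 0 then 1 else 0) else 0) else 0) = 0 := by
    split_ifs <;> first | rfl | tauto
  by_cases hi : i = 0
  · have t6 : (if j = 3 then (if s = 2 then 1 else 0) else 0) = 0 := by
      split_ifs <;> first | rfl | tauto
    have t7 : (if j % 2 = 1 then e j - e (j + 1) else 0) = 0 := by
      split_ifs with hj
      · exact Nat.sub_eq_zero_of_le (h7 hi hj)
      · rfl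
    simp only [upperMult, if_neg h1, t2, t6, t7, if_neg (h3 hi), if_neg (h4 hi),
      if_neg (h5 hi), add_zero, ite_self, le_refl]
  · simp only [upperMult, if_neg h1, t2, t8, if_neg hi, add_zero, le_refl]

lemma exists_common_neighbor {n s : ℕ} (hn : 5 ≤ n) (e : ℕ → ℕ)
    (hsort : ∀ b, b % 2 = 1 → b + 3 < n → e (b + 3) < e (b + 2) → e (b + 1) < e b)
    {i j : ℕ} (hj : j < n) (h : 0 < upperMult n s e i j) :
    ∃ k < n, 0 < upperMult n s e i k + upperMult n s e k i ∧
      0 < upperMult n s e j k + upperMult n s e k j := by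
  have pos_succ : ∀ a, 0 < upperMult n s e a (a + 1) := by
    intro a; simp [upperMult]
  have pos_add_two : ∀ a, ¬ (s = 2 ∧ a = 1) → 0 < upperMult n s e a (a + 2) := by
    intro a ha; simp [upperMult, ha]
  have pos_last : 0 < upperMult n s e 0 (n - 1) := by
    simp [upperMult]; split_ifs <;> omega
  have pos_penult : 0 < upperMult n s e 0 (n - 2) := by
    simp [upperMult]
  have pos_odd : ∀ b, b % 2 = 1 → e (b + 1) < e b → 0 < upperMult n s e 0 b := by
    intro b hb hlt; simp [upperMult, hb]; omega
  have hpen : 0 < upperMult n s e (n - 2) (n - 1) := by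
    have := pos_succ (n - 2)
    rwa [show n - 2 + 1 = n - 1 by omega] at this
  have h01 := pos_succ 0
  have h12 := pos_succ 1
  have h23 := pos_succ 2
  have h02 := pos_add_two 0 (by omega)
  simp only [zero_add, Nat.reduceAdd] at h01 h12 h23 h02
  rcases cases_of_upperMult_pos h with rfl | ⟨rfl, h1⟩ | ⟨rfl, rfl⟩ | ⟨rfl, rfl⟩ | ⟨rfl, rfl⟩ | ⟨rfl, rfl, h1⟩ |
    ⟨rfl, h1, h2⟩ | ⟨rfl, rfl, h1⟩
  · by_cases h1 : s = 2 ∧ i = 1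
    · obtain ⟨-, rfl⟩ := h1
      exact ⟨0, by omega, by omega, by simp only [Nat.reduceAdd]; omega⟩
    · by_cases h2 : i + 2 < n
      · exact ⟨i + 2, h2, by have := pos_add_two i h1; omega, by
          have := pos_succ (i + 1); simp only [add_assoc, Nat.reduceAdd] at this ⊢; omega⟩
      · obtain rfl : i = n - 2 := by omega
        rw [show n - 2 + 1 = n - 1 by omega]
        exact ⟨0, by omega, by omega, by omega⟩
  · exact ⟨i + 1, by omega, by have := pos_succ i; omega, by
      have := pos_succ (i + 1); simp only [add_assoc, Nat.reduceAdd] at this ⊢; omega⟩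
  · exact ⟨n - 1, by omega, by omega, by omega⟩
  · exact ⟨n - 2, by omega, by omega, by omega⟩
  · exact ⟨2, by omega, by omega, by omega⟩
  · exact ⟨2, by omega, by omega, by omega⟩
  · by_cases hj1 : j = 1
    · subst hj1
      exact ⟨2, by omega, by omega, by omega⟩
    by_cases hj3 : j = 3
    · subst hj3
      by_cases hs2 : s = 2
      · exact ⟨2, by omega, by omega, by omega⟩
      · have h13 := pos_add_two 1 (by omega)
        simp only [Nat.reduceAdd] at h13
        exact ⟨1, by omega, by omega, by omega⟩
    by_cases hjn : j = n - 1
    · subst hjn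
      exact ⟨n - 2, by omega, by omega, by omega⟩
    obtain ⟨b, rfl⟩ : ∃ b, j = b + 2 := ⟨j - 2, by omega⟩
    have hb : b % 2 = 1 := by omega
    have h3 := pos_odd b hb (hsort b hb (by omega) h2)
    have h4 := pos_add_two b (by omega)
    exact ⟨b, by omega, by omega, by omega⟩
  · exact ⟨0, by omega, by omega, by omega⟩

/-- Realization of the degree sequence `4 + 2 * s + ∑ (e b - e (b + 1)), 4 + e 1, …, 4 + e (n - 1)`
when the pairs `(b, b + 1)`, `b` odd, with `e (b + 1) < e b` come first. -/
lemma exists_triangular_of_sorted {n s : ℕ} (hn : 5 ≤ n) (hs : s = 0 ∨ 6 ≤ n ∧ s ≤ 2) (e : ℕ → ℕ)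
    (he : ∀ b, n ≤ b → e b = 0) (hmono : ∀ b, b % 2 = 1 → e (b + 1) ≤ e b)
    (hsort : ∀ b, b % 2 = 1 → b + 3 < n → e (b + 3) < e (b + 2) → e (b + 1) < e b) :
    ∃ m : ℕ → ℕ → ℕ, (∀ i j, m i j = m j i) ∧ (∀ i, m i i = 0) ∧
      (∀ i < n, ∀ j < n, 0 < m i j → ∃ k < n, 0 < m i k ∧ 0 < m j k) ∧
      (∑ j ∈ Finset.range n, m 0 j
        = 4 + 2 * s + ∑ b ∈ Finset.range n, if b % 2 = 1 then e b - e (b + 1) else 0) ∧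
      ∀ i, 1 ≤ i → i < n → ∑ j ∈ Finset.range n, m i j = 4 + e i := by
  refine ⟨fun i j => upperMult n s e i j + upperMult n s e j i, fun i j => add_comm _ _,
    fun i => by simp [upperMult_eq_zero hn e le_rfl], ?_, ?_, ?_⟩
  · intro i hi j hj h
    beta_reduce at h
    rcases Nat.eq_zero_or_pos (upperMult n s e i j) with h0 | h0
    · obtain ⟨k, hk, h1, h2⟩ := exists_common_neighbor hn e hsort hi
        (show 0 < upperMult n s e j i by omega)
      exact ⟨k, hk, h2, h1⟩
    · exact exists_common_neighbor hn e hsort hj h0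
  · rw [Finset.sum_add_distrib, sum_upperMult_zero hn e (by omega)]
    simp [upperMult_eq_zero hn e (Nat.zero_le _)]
  · intro i hi hin
    rw [Finset.sum_add_distrib, sum_upperMult_right e hi, sum_upperMult_left hn e hi hin]
    have h1 := hmono i
    have h2 := he (i + 1)
    grind

/-- The permutation of `ℕ` that permutes the pairs `(2 * j + 1, 2 * j + 2)` according to `σ`. -/
def pairPerm (σ : Equiv.Perm ℕ) : Equiv.Perm ℕ where
  toFun i := if i = 0 then 0 else 2 * σ ((i - 1) / 2) + 1 + (i - 1) % 2
  invFun i := if i = 0 then 0 else 2 * σ.symm ((i - 1) / 2) + 1 + (i - 1) % 2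
  left_inv i := by
    rcases Nat.eq_zero_or_pos i with rfl | h
    · simp
    · have h1 : (2 * σ ((i - 1) / 2) + 1 + (i - 1) % 2 - 1) / 2 = σ ((i - 1) / 2) := by omega
      simp only [show i ≠ 0 by omega, if_false, h1, Equiv.symm_apply_apply]
      split_ifs <;> omega
  right_inv i := by
    rcases Nat.eq_zero_or_pos i with rfl | h
    · simp
    · have h1 : (2 * σ.symm ((i - 1) / 2) + 1 + (i - 1) % 2 - 1) / 2 = σ.symm ((i - 1) / 2) := by
        omega
      simp only [show i ≠ 0 by omega, if_false, h1, Equiv.apply_symm_apply]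
      split_ifs <;> omega

lemma pairPerm_odd (σ : Equiv.Perm ℕ) (j : ℕ) : pairPerm σ (2 * j + 1) = 2 * σ j + 1 := by
  simp [pairPerm]

lemma pairPerm_even (σ : Equiv.Perm ℕ) (j : ℕ) : pairPerm σ (2 * j + 2) = 2 * σ j + 2 := by
  have h1 : (2 * j + 1) / 2 = j := by omega
  have h2 : (2 * j + 1) % 2 = 1 := by omega
  simp [pairPerm, h1, h2]

/-- Any `ℕ`-valued function can be sorted in decreasing order on an initial segment. -/
lemma exists_perm_antitone (k : ℕ) (f : ℕ → ℕ) :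
    ∃ σ : Equiv.Perm ℕ, (∀ j, k ≤ j → σ j = j) ∧ (∀ j, j < k → σ j < k) ∧
      ∀ i j, i ≤ j → j < k → f (σ j) ≤ f (σ i) := by
  let g : Fin k → ℕᵒᵈ := fun j => OrderDual.toDual (f j)
  let τ := Tuple.sort g
  have hτ : Monotone (g ∘ τ) := Tuple.monotone_sort g
  let σ : Equiv.Perm ℕ :=
    { toFun := fun j => if h : j < k then τ ⟨j, h⟩ else j
      invFun := fun j => if h : j < k then τ.symm ⟨j, h⟩ else j
      left_inv := fun j => by
        by_cases h : j < k <;> simp [h]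
      right_inv := fun j => by
        by_cases h : j < k <;> simp [h] }
  have hσ : ∀ j (h : j < k), σ j = τ ⟨j, h⟩ := fun j h => by simp [σ, h]
  refine ⟨σ, fun j h => by simp [σ, not_lt.2 h], fun j h => by rw [hσ j h]; exact (τ _).2, ?_⟩
  intro i j hij hj
  rw [hσ j hj, hσ i (hij.trans_lt hj)]
  exact hτ (show (⟨i, hij.trans_lt hj⟩ : Fin k) ≤ ⟨j, hj⟩ from hij)

lemma alternating_sum_eq (f : ℕ → ℤ) (n : ℕ) (hn : 1 ≤ n) :
    ∑ i ∈ Finset.range n, (-1 : ℤ) ^ i * f i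
      = f 0 - (∑ b ∈ Finset.range n, if b % 2 = 1 then f b - f (b + 1) else 0)
        - if n % 2 = 0 then f n else 0 := by
  induction n, hn using Nat.le_induction with
  | base => simp
  | succ n hn ih =>
    rw [Finset.sum_range_succ, Finset.sum_range_succ, ih]
    rcases Nat.mod_two_eq_zero_or_one n with h | h
    · rw [Even.neg_one_pow (Nat.even_iff.2 h)]
      simp [h, show (n + 1) % 2 = 1 by omega]
    · rw [Odd.neg_one_pow (Nat.odd_iff.2 h)]
      simp [h, show (n + 1) % 2 = 0 by omega]
      ring

/-- Realization of the degree sequence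
`4 + 2 * s + ∑ (e b - e (b + 1)), 4 + e 1, …, 4 + e (n - 1)`. -/
lemma exists_triangular {n s : ℕ} (hn : 5 ≤ n) (hs : s = 0 ∨ 6 ≤ n ∧ s ≤ 2) (e : ℕ → ℕ)
    (he : ∀ b, n ≤ b → e b = 0) (hmono : ∀ b, b % 2 = 1 → e (b + 1) ≤ e b) :
    ∃ m : ℕ → ℕ → ℕ, (∀ i j, m i j = m j i) ∧ (∀ i, m i i = 0) ∧
      (∀ i < n, ∀ j < n, 0 < m i j → ∃ k < n, 0 < m i k ∧ 0 < m j k) ∧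
      (∑ j ∈ Finset.range n, m 0 j
        = 4 + 2 * s + ∑ b ∈ Finset.range n, if b % 2 = 1 then e b - e (b + 1) else 0) ∧
      ∀ i, 1 ≤ i → i < n → ∑ j ∈ Finset.range n, m i j = 4 + e i := by
  obtain ⟨σ, hfix, hlt, hanti⟩ :=
    exists_perm_antitone ((n - 1) / 2) (fun j => e (2 * j + 1) - e (2 * j + 2))
  have hcases : ∀ i : ℕ, i = 0 ∨ (∃ j, i = 2 * j + 1) ∨ ∃ j, i = 2 * j + 2 := by
    intro i
    rcases Nat.even_or_odd' i with ⟨c, rfl | rfl⟩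
    · rcases c with _ | c
      · exact Or.inl rfl
      · exact Or.inr (Or.inr ⟨c, by ring⟩)
    · exact Or.inr (Or.inl ⟨c, rfl⟩)
  set π := pairPerm σ with hπ
  have hπ0 : π 0 = 0 := by simp [hπ, pairPerm]
  have hπlt : ∀ i, π i < n ↔ i < n := by
    intro i
    rcases hcases i with rfl | ⟨j, rfl⟩ | ⟨j, rfl⟩
    · rw [hπ0]
    · rw [hπ, pairPerm_odd]
      have h1 := hfix j
      have h2 := hlt j
      omega
    · rw [hπ, pairPerm_even]
      have h1 := hfix j
      have h2 := hlt j
      omega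
  have hsymm : ∀ i, π.symm i < n ↔ i < n := fun i => by
    rw [← hπlt, Equiv.apply_symm_apply]
  have hodd : ∀ b, b % 2 = 1 → ∃ j, b = 2 * j + 1 := fun b hb => ⟨b / 2, by omega⟩
  obtain ⟨m, hm1, hm2, hm3, hm4, hm5⟩ :=
    exists_triangular_of_sorted hn hs (fun i => e (π i))
      (fun b hb => he _ (by have := hπlt b; omega))
      (fun b hb => by
        obtain ⟨j, rfl⟩ := hodd b hb
        simp only [hπ, pairPerm_odd, add_assoc, Nat.reduceAdd, pairPerm_even]
        exact hmono (2 * σ j + 1) (by omega))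
      (fun b hb hbn h => by
        obtain ⟨j, rfl⟩ := hodd b hb
        rw [show 2 * j + 1 + 3 = 2 * (j + 1) + 2 by ring,
          show 2 * j + 1 + 2 = 2 * (j + 1) + 1 by ring] at h
        simp only [hπ, pairPerm_odd, add_assoc, Nat.reduceAdd, pairPerm_even] at h ⊢
        have := hanti j (j + 1) (by omega) (by omega)
        omega)
  have hsum : ∀ i, ∑ j ∈ Finset.range n, m (π.symm i) (π.symm j)
      = ∑ j ∈ Finset.range n, m (π.symm i) j := fun i =>
    Finset.sum_equiv π.symm (fun j => by simp [hsymm]) (fun j _ => rfl)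
  have hs0 : π.symm 0 = 0 := by rw [Equiv.symm_apply_eq, hπ0]
  refine ⟨fun i j => m (π.symm i) (π.symm j), fun i j => hm1 _ _, fun i => hm2 _, ?_, ?_, ?_⟩
  · intro i hi j hj h
    obtain ⟨k, hk, h1, h2⟩ := hm3 _ ((hsymm i).2 hi) _ ((hsymm j).2 hj) h
    exact ⟨π k, (hπlt k).2 hk, by simpa using h1, by simpa using h2⟩
  · rw [hsum, hs0, hm4]
    congr 1
    refine Finset.sum_equiv π (fun j => by simp [hπlt]) (fun b _ => ?_)
    rcases hcases b with rfl | ⟨j, rfl⟩ | ⟨j, rfl⟩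
    · simp [hπ0]
    · simp only [hπ, pairPerm_odd, add_assoc, Nat.reduceAdd, pairPerm_even]
      rw [if_pos (by omega), if_pos (by omega)]
    · simp only [hπ, pairPerm_even]
      rw [if_neg (by omega), if_neg (by omega)]
  · intro i hi hin
    rw [hsum, hm5 _ _ ((hsymm i).2 hin), Equiv.apply_symm_apply]
    by_contra hcon
    have h0 : π.symm i = 0 := by omega
    rw [Equiv.symm_apply_eq, hπ0] at h0
    omega

theorem stmt_8 (n : ℕ) (hn : 5 ≤ n) (d : Fin n → ℕ)
    (hanti : ∀ i j : Fin n, 1 ≤ (i : ℕ) → i ≤ j → d j ≤ d i)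
    (h4 : ∀ i : Fin n, 1 ≤ (i : ℕ) → 4 ≤ d i)
    (hD : (Odd n → ∑ i : Fin n, (-1 : ℤ) ^ (i : ℕ) * (d i : ℤ) = 4) ∧
          (Even n → ∑ i : Fin n, (-1 : ℤ) ^ (i : ℕ) * (d i : ℤ) = 0 ∨
                    ∑ i : Fin n, (-1 : ℤ) ^ (i : ℕ) * (d i : ℤ) = 2 ∨
                    ∑ i : Fin n, (-1 : ℤ) ^ (i : ℕ) * (d i : ℤ) = 4)) :
    ∃ m : Fin n → Fin n → ℕ,
      (∀ i j : Fin n, m i j = m j i) ∧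
      (∀ i : Fin n, m i i = 0) ∧
      Triangular m ∧
      (∀ i : Fin n, ∑ j, m i j = d i) := by
  let f : ℕ → ℕ := fun i => if h : i < n then d ⟨i, h⟩ else 4
  have hf : ∀ i : Fin n, f i = d i := fun i => by simp [f]
  have hf4 : ∀ i, 1 ≤ i → 4 ≤ f i := by
    intro i hi
    by_cases h : i < n
    · simpa [f, h] using h4 ⟨i, h⟩ hi
    · simp [f, h]
  have hfn : ∀ i, n ≤ i → f i = 4 := fun i h => by simp [f, not_lt.2 h]
  have hmono : ∀ b, 1 ≤ b → f (b + 1) ≤ f b := by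
    intro b hb
    by_cases h : b + 1 < n
    · have := hanti ⟨b, by omega⟩ ⟨b + 1, h⟩ hb (by simp)
      rwa [← hf, ← hf] at this
    · rw [hfn (b + 1) (by omega)]
      exact hf4 b hb
  have halt : ∑ i : Fin n, (-1 : ℤ) ^ (i : ℕ) * (d i : ℤ)
      = f 0 - ((∑ b ∈ Finset.range n,
          if b % 2 = 1 then (f b - 4) - (f (b + 1) - 4) else 0 : ℕ) : ℤ)
        - if n % 2 = 0 then 4 else 0 := by
    simp_rw [← hf]
    rw [Fin.sum_univ_eq_sum_range (fun i => (-1 : ℤ) ^ i * (f i : ℤ)),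
      alternating_sum_eq (fun i => (f i : ℤ)) n (by omega), hfn n le_rfl, Nat.cast_sum]
    congr 2
    refine Finset.sum_congr rfl fun b _ => ?_
    split_ifs with hb
    · have h1 := hmono b (by omega)
      have h2 := hf4 (b + 1) (by omega)
      omega
    · simp
  rw [halt] at hD
  have hs : ∃ s, (s = 0 ∨ 6 ≤ n ∧ s ≤ 2) ∧ f 0 = 4 + 2 * s + ∑ b ∈ Finset.range n,
      if b % 2 = 1 then (f b - 4) - (f (b + 1) - 4) else 0 := by
    rcases Nat.even_or_odd n with h | h
    · have hn2 := Nat.even_iff.1 h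
      rw [if_pos hn2] at hD
      rcases hD.2 h with h | h | h
      · exact ⟨0, by omega, by omega⟩
      · exact ⟨1, by omega, by omega⟩
      · exact ⟨2, by omega, by omega⟩
    · have hn2 := Nat.odd_iff.1 h
      rw [if_neg (by omega)] at hD
      have := hD.1 h
      exact ⟨0, by omega, by omega⟩
  obtain ⟨s, hs, hf0⟩ := hs
  obtain ⟨m, hm1, hm2, hm3, hm4, hm5⟩ := exists_triangular hn hs (fun i => f i - 4)
    (fun b hb => by simp [hfn b hb])
    (fun b hb => Nat.sub_le_sub_right (hmono b (by omega)) 4)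
  refine ⟨fun i j => m i j, fun i j => hm1 _ _, fun i => hm2 _, ?_, ?_⟩
  · intro i j _ h
    obtain ⟨k, hk, h1, h2⟩ := hm3 i i.2 j j.2 h
    refine ⟨⟨k, hk⟩, ?_, ?_, h1, h2⟩
    · rintro rfl
      simp [hm2] at h1
    · rintro rfl
      simp [hm2] at h2
  · intro i
    rw [Fin.sum_univ_eq_sum_range (fun j => m i j), ← hf]
    rcases Nat.eq_zero_or_pos (i : ℕ) with h | h
    · rw [h, hm4, hf0]
    · rw [hm5 i h i.2]
      have := hf4 i h
      omega
end

section
/- Let n ≥ 5 be odd and let (d₁,…,dₙ) be a sequence of non-negative integers satisfying d₂ ≥ d₃ ≥ ⋯ ≥ dₙ ≥ 4 and Σ_{i=1}^{n} (−1)^{i−1} dᵢ = 4. Then there exists a triangular multigraph on n vertices v₁,…,vₙ with deg(vᵢ) = dᵢ for all i ∈ [n]. -/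
/-- A degree sequence is realizable if it is the degree sequence of a triangular multigraph. -/
def Realizable {n : ℕ} (d : Fin n → ℕ) : Prop :=
  ∃ m : Fin n → Fin n → ℕ,
    (∀ i j : Fin n, m i j = m j i) ∧
    (∀ i : Fin n, m i i = 0) ∧
    Triangular m ∧
    (∀ i : Fin n, ∑ j, m i j = d i)

/-- The superposition of two triangular multigraphs is triangular. -/
theorem Realizable.add {n : ℕ} {d e : Fin n → ℕ} (hd : Realizable d) (he : Realizable e) :
    Realizable (d + e) := by
  obtain ⟨m, hms, hm0, hmt, hmd⟩ := hd
  obtain ⟨p, hps, hp0, hpt, hpd⟩ := he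
  refine ⟨fun i j => m i j + p i j, fun i j => by simp only [hms i, hps i],
    fun i => by simp only [hm0, hp0],
    fun i j hij hpos => ?_, fun i => by simp [Finset.sum_add_distrib, hmd, hpd]⟩
  rcases Nat.eq_zero_or_pos (m i j) with h | h
  · obtain ⟨k, h1, h2, h3, h4⟩ := hpt i j hij (by simpa [h] using hpos)
    exact ⟨k, h1, h2, Nat.add_pos_right _ h3, Nat.add_pos_right _ h4⟩
  · obtain ⟨k, h1, h2, h3, h4⟩ := hmt i j hij h
    exact ⟨k, h1, h2, Nat.add_pos_left h3 _, Nat.add_pos_left h4 _⟩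

/-- The list `l` of weighted edges has an edge of positive weight between `u` and `v`. -/
def Joins {n : ℕ} (l : List (Fin n × Fin n × ℕ)) (u v : Fin n) : Prop :=
  ∃ e ∈ l, 0 < e.2.2 ∧ ((u = e.1 ∧ v = e.2.1) ∨ (u = e.2.1 ∧ v = e.1))

/-- The multiplicity function of a list of weighted edges. -/
def edgeMult {n : ℕ} (l : List (Fin n × Fin n × ℕ)) (x y : Fin n) : ℕ :=
  (l.map fun e =>
    if (x = e.1 ∧ y = e.2.1) ∨ (x = e.2.1 ∧ y = e.1) then e.2.2 else 0).sum

theorem edgeMult_pos_iff {n : ℕ} (l : List (Fin n × Fin n × ℕ)) (x y : Fin n) :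
    0 < edgeMult l x y ↔ Joins l x y := by
  induction l with
  | nil => simp [edgeMult, Joins]
  | cons e l ih =>
    have h : edgeMult (e :: l) x y =
        (if (x = e.1 ∧ y = e.2.1) ∨ (x = e.2.1 ∧ y = e.1) then e.2.2 else 0) +
          edgeMult l x y := by simp [edgeMult]
    rw [h, Nat.add_pos_iff_pos_or_pos, ih]
    simp only [Joins, List.exists_mem_cons_iff]
    split_ifs with hc <;> simp [hc]

theorem sum_edgeMult {n : ℕ} (l : List (Fin n × Fin n × ℕ)) (hne : ∀ e ∈ l, e.1 ≠ e.2.1)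
    (x : Fin n) :
    ∑ y, edgeMult l x y =
      (l.map fun e => (Pi.single e.1 e.2.2 + Pi.single e.2.1 e.2.2 : Fin n → ℕ)).sum x := by
  induction l with
  | nil => simp [edgeMult]
  | cons e l ih =>
    have h (y : Fin n) : edgeMult (e :: l) x y =
        (if (x = e.1 ∧ y = e.2.1) ∨ (x = e.2.1 ∧ y = e.1) then e.2.2 else 0) +
          edgeMult l x y := by simp [edgeMult]
    simp only [List.forall_mem_cons] at hne
    simp only [h, Finset.sum_add_distrib, ih hne.2, List.map_cons, List.sum_cons, Pi.add_apply,
      Pi.single_apply]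
    have hne' := hne.1
    by_cases h1 : x = e.1
    · subst h1; simp [hne']
    · by_cases h2 : x = e.2.1
      · simp [h2, hne'.symm]
      · simp [h1, h2]

/-- A list of weighted edges in which every edge of positive weight lies in a triangle realizes its
degree sequence. -/
theorem realizable_of_edges {n : ℕ} (l : List (Fin n × Fin n × ℕ))
    (hne : ∀ e ∈ l, e.1 ≠ e.2.1)
    (ht : ∀ e ∈ l, 0 < e.2.2 → ∃ w, w ≠ e.1 ∧ w ≠ e.2.1 ∧ Joins l e.1 w ∧ Joins l e.2.1 w) :
    Realizable (l.map fun e => (Pi.single e.1 e.2.2 + Pi.single e.2.1 e.2.2 : Fin n → ℕ)).sum := by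
  refine ⟨edgeMult l, fun i j => ?_, fun i => ?_, fun i j hij hpos => ?_, sum_edgeMult l hne⟩
  · simp only [edgeMult]
    congr 2
    funext e
    congr 1
    simp only [eq_iff_iff]
    tauto
  · refine Nat.eq_zero_of_not_pos fun h => ?_
    obtain ⟨e, he, -, h⟩ := (edgeMult_pos_iff l i i).1 h
    exact hne e he (by rcases h with ⟨h1, h2⟩ | ⟨h1, h2⟩ <;> rw [← h1, ← h2])
  · obtain ⟨e, he, hc, h⟩ := (edgeMult_pos_iff l i j).1 hpos
    obtain ⟨w, h1, h2, h3, h4⟩ := ht e he hc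
    simp only [edgeMult_pos_iff]
    rcases h with ⟨rfl, rfl⟩ | ⟨rfl, rfl⟩
    · exact ⟨w, h1, h2, h3, h4⟩
    · exact ⟨w, h2, h1, h4, h3⟩

theorem pi_single_apply_eq_mul {n : ℕ} (u : Fin n) (c : ℕ) (x : Fin n) :
    (Pi.single u c : Fin n → ℕ) x = c * if x = u then 1 else 0 := by
  simp [Pi.single_apply]

/-- Two vertex pairs with excesses both zero or both positive are attached to a hub `v`, using only
their excesses at `v`. -/
theorem realizable_two_pairs {n : ℕ} {v a₁ b₁ a₂ b₂ : Fin n} (h : [v, a₁, b₁, a₂, b₂].Nodup)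
    {δ₁ δ₂ c₁ c₂ : ℕ} (hδ : δ₁ = 0 ↔ δ₂ = 0) (h₁ : 4 ≤ c₁) (h₂ : 4 ≤ c₂) :
    Realizable (Pi.single v (δ₁ + δ₂) + (Pi.single a₁ (c₁ + δ₁) + Pi.single b₁ c₁) +
      (Pi.single a₂ (c₂ + δ₂) + Pi.single b₂ c₂) : Fin n → ℕ) := by
  obtain ⟨c₁, rfl⟩ := Nat.exists_eq_add_of_le h₁
  obtain ⟨c₂, rfl⟩ := Nat.exists_eq_add_of_le h₂
  have hpos : 0 < δ₁ ↔ 0 < δ₂ := by omega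
  simp only [List.nodup_cons, List.mem_cons, List.not_mem_nil, or_false, not_or] at h
  obtain ⟨⟨_, _, _, _⟩, ⟨_, _, _⟩, ⟨_, _⟩, _, _⟩ := h
  convert realizable_of_edges [(v, a₁, δ₁), (v, a₂, δ₂), (a₁, b₁, c₁ + 2), (a₂, b₂, c₂ + 2),
    (a₁, a₂, 1), (a₁, b₂, 1), (b₁, a₂, 1), (b₁, b₂, 1)] ?_ ?_ using 1
  · funext x
    simp only [List.map_cons, List.map_nil, List.sum_cons, List.sum_nil, Pi.add_apply,
      Pi.zero_apply, pi_single_apply_eq_mul]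
    ring
  · simp [*]
  · simp only [List.forall_mem_cons, Joins, List.exists_mem_cons_iff]
    refine ⟨fun _ => ⟨a₂, ?_⟩, fun _ => ⟨a₁, ?_⟩, fun _ => ⟨a₂, ?_⟩, fun _ => ⟨a₁, ?_⟩,
      fun _ => ⟨b₁, ?_⟩, fun _ => ⟨b₁, ?_⟩, fun _ => ⟨b₂, ?_⟩, fun _ => ⟨a₁, ?_⟩, by simp⟩ <;>
    grind

/-- Two triangles sharing a hub `v`. -/
theorem realizable_hub_two {n : ℕ} {v a₁ b₁ a₂ b₂ : Fin n} (h : [v, a₁, b₁, a₂, b₂].Nodup)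
    {δ₁ δ₂ c₁ c₂ : ℕ} (h₁ : 4 ≤ c₁) (h₂ : 4 ≤ c₂) :
    Realizable (Pi.single v (4 + (δ₁ + δ₂)) + ((Pi.single a₁ (c₁ + δ₁) + Pi.single b₁ c₁) +
      (Pi.single a₂ (c₂ + δ₂) + Pi.single b₂ c₂)) : Fin n → ℕ) := by
  obtain ⟨c₁, rfl⟩ := Nat.exists_eq_add_of_le h₁
  obtain ⟨c₂, rfl⟩ := Nat.exists_eq_add_of_le h₂
  simp only [List.nodup_cons, List.mem_cons, List.not_mem_nil, or_false, not_or] at h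
  obtain ⟨⟨_, _, _, _⟩, ⟨_, _, _⟩, ⟨_, _⟩, _, _⟩ := h
  convert realizable_of_edges [(v, a₁, δ₁ + 1), (v, b₁, 1), (a₁, b₁, c₁ + 3),
    (v, a₂, δ₂ + 1), (v, b₂, 1), (a₂, b₂, c₂ + 3)] ?_ ?_ using 1
  · funext x
    simp only [List.map_cons, List.map_nil, List.sum_cons, List.sum_nil, Pi.add_apply,
      Pi.zero_apply, pi_single_apply_eq_mul]
    ring
  · simp [*]
  · simp only [List.forall_mem_cons, Joins, List.exists_mem_cons_iff]
    refine ⟨fun _ => ⟨b₁, ?_⟩, fun _ => ⟨a₁, ?_⟩, fun _ => ⟨v, ?_⟩,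
      fun _ => ⟨b₂, ?_⟩, fun _ => ⟨a₂, ?_⟩, fun _ => ⟨v, ?_⟩, by simp⟩ <;>
    grind

/-- Two triangles sharing a hub `v`, with a third pair attached to the edge `a₁ b₁`. -/
theorem realizable_hub_three {n : ℕ} {v a₁ b₁ a₂ b₂ a₃ b₃ : Fin n}
    (h : [v, a₁, b₁, a₂, b₂, a₃, b₃].Nodup)
    {δ₁ δ₂ δ₃ c₁ c₂ c₃ : ℕ} (h₁ : 4 ≤ c₁) (h₂ : 4 ≤ c₂) (h₃ : 4 ≤ c₃) :
    Realizable (Pi.single v (4 + (δ₁ + (δ₂ + δ₃))) +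
      ((Pi.single a₁ (c₁ + δ₁) + Pi.single b₁ c₁) + ((Pi.single a₂ (c₂ + δ₂) + Pi.single b₂ c₂) +
      (Pi.single a₃ (c₃ + δ₃) + Pi.single b₃ c₃))) : Fin n → ℕ) := by
  obtain ⟨c₁, rfl⟩ := Nat.exists_eq_add_of_le h₁
  obtain ⟨c₂, rfl⟩ := Nat.exists_eq_add_of_le h₂
  obtain ⟨c₃, rfl⟩ := Nat.exists_eq_add_of_le h₃
  simp only [List.nodup_cons, List.mem_cons, List.not_mem_nil, or_false, not_or] at h
  obtain ⟨⟨_, _, _, _, _, _⟩, ⟨_, _, _, _, _⟩, ⟨_, _, _, _⟩, ⟨_, _, _⟩, ⟨_, _⟩, _, _⟩ := h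
  convert realizable_of_edges [(v, a₁, δ₁ + 1), (v, b₁, 1), (a₁, b₁, c₁ + 1),
    (v, a₂, δ₂ + 1), (v, b₂, 1), (a₂, b₂, c₂ + 3), (v, a₃, δ₃), (a₃, b₃, c₃ + 2),
    (a₁, a₃, 1), (a₁, b₃, 1), (b₁, a₃, 1), (b₁, b₃, 1)] ?_ ?_ using 1
  · funext x
    simp only [List.map_cons, List.map_nil, List.sum_cons, List.sum_nil, Pi.add_apply,
      Pi.zero_apply, pi_single_apply_eq_mul]
    ring
  · simp [*]
  · simp only [List.forall_mem_cons, Joins, List.exists_mem_cons_iff]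
    refine ⟨fun _ => ⟨b₁, ?_⟩, fun _ => ⟨a₁, ?_⟩, fun _ => ⟨v, ?_⟩,
      fun _ => ⟨b₂, ?_⟩, fun _ => ⟨a₂, ?_⟩, fun _ => ⟨v, ?_⟩, fun _ => ⟨a₁, ?_⟩,
      fun _ => ⟨a₁, ?_⟩, fun _ => ⟨b₁, ?_⟩, fun _ => ⟨b₁, ?_⟩, fun _ => ⟨a₁, ?_⟩,
      fun _ => ⟨a₁, ?_⟩, by simp⟩ <;>
    grind

/-- A hub `v` together with at least two pairs `(A i, B i)` of degrees `c i + δ i` and `c i` is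
realizable as soon as the hub has degree `4 + ∑ δ i`. -/
theorem realizable_hub {n : ℕ} {ι : Type*} [DecidableEq ι] (v : Fin n) (A B : ι → Fin n)
    (hA : A.Injective) (hB : B.Injective) (hAB : ∀ i j, A i ≠ B j) (hvA : ∀ i, v ≠ A i)
    (hvB : ∀ i, v ≠ B i) (c δ : ι → ℕ) (hc : ∀ i, 4 ≤ c i) (S : Finset ι) (hS : 2 ≤ S.card) :
    Realizable (Pi.single v (4 + ∑ i ∈ S, δ i) +
      ∑ i ∈ S, (Pi.single (A i) (c i + δ i) + Pi.single (B i) (c i)) : Fin n → ℕ) := by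
  have hBA (i j) : B i ≠ A j := (hAB j i).symm
  induction S using Finset.strongInduction with
  | H S ih =>
  by_cases h2 : S.card = 2
  · obtain ⟨i, j, hij, rfl⟩ := Finset.card_eq_two.1 h2
    rw [Finset.sum_pair hij, Finset.sum_pair hij]
    exact realizable_hub_two (by simp [hA.eq_iff, hB.eq_iff, *]) (hc i) (hc j)
  by_cases h3 : S.card = 3
  · obtain ⟨i, j, k, hij, hik, hjk, rfl⟩ := Finset.card_eq_three.1 h3
    rw [Finset.sum_insert (by simp [*]), Finset.sum_pair hjk,
      Finset.sum_insert (by simp [*]), Finset.sum_pair hjk]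
    exact realizable_hub_three (by simp [hA.eq_iff, hB.eq_iff, *]) (hc i) (hc j) (hc k)
  obtain ⟨i, hi, j, hj, hij, hδ⟩ := Finset.exists_ne_map_eq_of_card_lt_of_maps_to
    (s := S) (t := (Finset.univ : Finset Bool)) (f := fun i => decide (δ i = 0))
    (by simp; omega) (fun _ _ => by simp only [Finset.coe_univ, Set.mem_univ])
  have hj' : j ∈ S.erase i := Finset.mem_erase.2 ⟨hij.symm, hj⟩
  have hcard : ((S.erase i).erase j).card + 2 = S.card := by
    rw [Finset.card_erase_of_mem hj', Finset.card_erase_of_mem hi]; omega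
  have hsub : (S.erase i).erase j ⊂ S :=
    (Finset.erase_subset _ _).trans_ssubset (Finset.erase_ssubset hi)
  convert (ih _ hsub (by omega)).add (realizable_two_pairs (v := v) (a₁ := A i) (b₁ := B i)
    (a₂ := A j) (b₂ := B j) (by simp [hA.eq_iff, hB.eq_iff, *]) (by simpa using hδ)
    (hc i) (hc j)) using 1
  rw [← Finset.add_sum_erase S _ hi, ← Finset.add_sum_erase _ _ hj',
    ← Finset.add_sum_erase S _ hi, ← Finset.add_sum_erase _ _ hj']
  simp only [Pi.single_add]
  abel

/-- Splitting a sum over `Fin (2 * k + 1)` into its first term and consecutive pairs. -/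
theorem Fin.sum_univ_two_mul_add_one {M : Type*} [AddCommMonoid M] (k : ℕ)
    (f : Fin (2 * k + 1) → M) :
    ∑ i, f i = f 0 + ∑ i : Fin k,
      (f ⟨2 * i + 1, by omega⟩ + f ⟨2 * i + 2, by omega⟩) := by
  induction k with
  | zero => simp
  | succ k ih =>
    rw [Fin.sum_univ_castSucc (n := k), ← add_assoc]
    have h := ih fun i => f ⟨i, by omega⟩
    change ∑ i : Fin (2 * k + 1 + 1 + 1), f i = _
    rw [Fin.sum_univ_castSucc, Fin.sum_univ_castSucc, add_assoc]
    exact congrArg₂ _ h rfl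

theorem stmt_9 (n : ℕ) (hn : 5 ≤ n) (hodd : Odd n) (d : Fin n → ℕ)
    (hanti : ∀ i j : Fin n, 1 ≤ (i : ℕ) → i ≤ j → d j ≤ d i)
    (h4 : ∀ i : Fin n, 1 ≤ (i : ℕ) → 4 ≤ d i)
    (hD : ∑ i : Fin n, (-1 : ℤ) ^ (i : ℕ) * (d i : ℤ) = 4) :
    ∃ m : Fin n → Fin n → ℕ,
      (∀ i j : Fin n, m i j = m j i) ∧
      (∀ i : Fin n, m i i = 0) ∧
      Triangular m ∧
      (∀ i : Fin n, ∑ j, m i j = d i) := by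
  obtain ⟨k, rfl⟩ := hodd
  let A (i : Fin k) : Fin (2 * k + 1) := ⟨2 * i + 1, by omega⟩
  let B (i : Fin k) : Fin (2 * k + 1) := ⟨2 * i + 2, by omega⟩
  have hle (i : Fin k) : d (B i) ≤ d (A i) :=
    hanti _ _ (by simp [A]) (by simp [A, B])
  have hd0 : d 0 = 4 + ∑ i, (d (A i) - d (B i)) := by
    rw [Fin.sum_univ_two_mul_add_one] at hD
    have hpair (i : Fin k) : (-1 : ℤ) ^ (2 * (i : ℕ) + 1) * (d (A i) : ℤ) +
        (-1) ^ (2 * (i : ℕ) + 2) * (d (B i) : ℤ) = -((d (A i) - d (B i) : ℕ) : ℤ) := by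
      rw [Nat.cast_sub (hle i), pow_succ, pow_add, pow_mul]
      norm_num
      ring
    have hsum := Finset.sum_congr (rfl : (Finset.univ : Finset (Fin k)) = _) fun i _ => hpair i
    simp only [A, B] at hsum
    rw [hsum, Finset.sum_neg_distrib] at hD
    simp only [Fin.val_zero, pow_zero, one_mul] at hD
    zify
    linarith
  have key := realizable_hub 0 A B (fun i j h => by simp [A] at h; omega)
    (fun i j h => by simp [B] at h; omega) (fun i j h => by simp [A, B] at h; omega)
    (fun i h => by simp [A, Fin.ext_iff] at h) (fun i h => by simp [B, Fin.ext_iff] at h)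
    (fun i => d (B i)) (fun i => d (A i) - d (B i)) (fun i => h4 _ (by simp [B])) Finset.univ
    (by simp; omega)
  simp only [← hd0, Nat.add_sub_cancel' (hle _)] at key
  rwa [← Fin.sum_univ_two_mul_add_one k fun i => (Pi.single i (d i) : Fin (2 * k + 1) → ℕ),
    Finset.univ_sum_single] at key
end

section
/- Let n ≥ 6 be even and let (d₁,…,dₙ) be a sequence of non-negative integers satisfying d₂ ≥ d₃ ≥ ⋯ ≥ dₙ ≥ 4 and Σ_{i=1}^{n} (−1)^{i−1} dᵢ ∈ {0, 2, 4}. Then there exists a triangular multigraph on n vertices v₁,…,vₙ with deg(vᵢ) = dᵢ for all i ∈ [n]. -/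
namespace TriangularMultigraph

/-- Multiplicity of the forward edge from `i` to `j` in the square of the cycle `0, 1, …, 2k + 1`,
corrected at the hub `0` so that the vertex degrees become `d` with alternating sum `D`. -/
def forward (k D : ℕ) (d : ℕ → ℕ) (i j : ℕ) : ℕ :=
  (if j = i + 1 then if i = 0 then 0 else 1 + if i % 2 = 1 then d (i + 1) - 4 else 0 else 0) +
  (if j = i + 2 then
    if i = 0 ∨ (i = 1 ∧ 2 ≤ D) ∨ (i + 1 = 2 * k ∧ 4 ≤ D) then 0 else 1 else 0) +
  (if i = 1 ∧ j = 2 * k + 1 then 1 else 0) +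
  (if i = 0 then
    (if j = 1 then if 2 ≤ D then 2 else 1 else 0) +
    (if j = 2 then 1 else 0) +
    (if j = 3 then if 2 ≤ D then 1 else 0 else 0) +
    (if j + 1 = 2 * k then if 4 ≤ D then 1 else 0 else 0) +
    (if j = 2 * k then 1 else 0) +
    (if j = 2 * k + 1 then (if 4 ≤ D then 2 else 1) + (d j - 4) else 0) +
    (if j % 2 = 1 ∧ j < 2 * k then d j - d (j + 1) else 0) else 0)

/-- The symmetric multiplicity function obtained from `forward`. -/
def mult (k D : ℕ) (d : ℕ → ℕ) (i j : ℕ) : ℕ := forward k D d i j + forward k D d j i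

lemma forward_triangle {k D : ℕ} {d : ℕ → ℕ} (hk : 2 ≤ k)
    (hchain : ∀ i, i + 1 < k → d (2 * i + 4) < d (2 * i + 3) → d (2 * i + 2) < d (2 * i + 1))
    {i j : ℕ} (hj : j < 2 * k + 2) (h : 0 < forward k D d i j) :
    ∃ l < 2 * k + 2, l ≠ i ∧ l ≠ j ∧ 0 < mult k D d i l ∧ 0 < mult k D d j l := by
  have hub_one : 0 < forward k D d 0 1 := by simp only [forward]; grind
  have hub_two : 0 < forward k D d 0 2 := by simp only [forward]; grind
  have hub_penult : 0 < forward k D d 0 (2 * k) := by simp only [forward]; grind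
  have hub_last : 0 < forward k D d 0 (2 * k + 1) := by simp only [forward]; grind
  have hub_three (hD : 2 ≤ D) : 0 < forward k D d 0 3 := by simp only [forward]; grind
  have hub_antepenult (hD : 4 ≤ D) : 0 < forward k D d 0 (2 * k - 1) := by
    simp only [forward]; grind
  have hub_odd (x : ℕ) (hx : x < k) (hlt : d (2 * x + 2) < d (2 * x + 1)) :
      0 < forward k D d 0 (2 * x + 1) := by simp only [forward]; grind
  have step_one (x : ℕ) (hx : x ≠ 0) : 0 < forward k D d x (x + 1) := by
    simp only [forward]; grind
  have step_two (x : ℕ) (hx : x ≠ 0) (hx1 : ¬ (x = 1 ∧ 2 ≤ D))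
      (hx2 : ¬ (x + 1 = 2 * k ∧ 4 ≤ D)) : 0 < forward k D d x (x + 2) := by
    simp only [forward]; grind
  have hcases : (i ≠ 0 ∧ j = i + 1) ∨
      (i ≠ 0 ∧ j = i + 2) ∨ (i = 1 ∧ j = 2 * k + 1) ∨
      (i = 0 ∧ (j = 1 ∨ j = 2 ∨ (j = 3 ∧ 2 ≤ D) ∨ (j = 2 * k - 1 ∧ 4 ≤ D) ∨ j = 2 * k ∨
        j = 2 * k + 1 ∨ ∃ x, 0 < x ∧ x < k ∧ j = 2 * x + 1 ∧ d (2 * x + 2) < d (2 * x + 1))) := by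
    by_cases hodd : i = 0 ∧ j % 2 = 1 ∧ j < 2 * k ∧ d (j + 1) < d j
    · obtain ⟨h0, h1, h2, h3⟩ := hodd
      by_cases j1 : j = 1
      · omega
      · refine Or.inr (Or.inr (Or.inr ⟨h0, ?_⟩))
        iterate 6 right
        have e : 2 * (j / 2) + 1 = j := by omega
        refine ⟨j / 2, by omega, by omega, by omega, ?_⟩
        rw [show 2 * (j / 2) + 2 = j + 1 by omega, e]
        exact h3
    · by_contra hc
      clear hub_one hub_two hub_penult hub_last hub_three hub_antepenult hub_odd step_one step_two
        hchain
      simp only [forward] at h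
      grind (splits := 30)
  unfold mult
  rcases hcases with ⟨hi, rfl⟩ | ⟨hi, rfl⟩ | ⟨rfl, rfl⟩ | ⟨rfl, hc⟩
  · by_cases h1 : i = 1
    · subst h1
      exact ⟨0, by omega, by omega, by omega, by omega, by simp only [Nat.reduceAdd]; omega⟩
    by_cases h2 : i = 2 * k
    · subst h2
      exact ⟨0, by omega, by omega, by omega, by omega, by omega⟩
    by_cases h3 : i + 1 = 2 * k ∧ 4 ≤ D
    · have := hub_antepenult h3.2
      rw [show 2 * k - 1 = i by omega] at this
      rw [← h3.1] at hub_penult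
      exact ⟨0, by omega, by omega, by omega, by omega, by omega⟩
    · have := step_two i hi (by omega) h3
      have := step_one (i + 1) (by omega)
      exact ⟨i + 2, by omega, by omega, by omega, by omega, by
        simp only [add_assoc, Nat.reduceAdd] at *; omega⟩
  · have := step_one i hi
    have := step_one (i + 1) (by omega)
    exact ⟨i + 1, by omega, by omega, by omega, by omega, by
      simp only [add_assoc, Nat.reduceAdd] at *; omega⟩
  · exact ⟨0, by omega, by omega, by omega, by omega, by omega⟩
  · have e12 := step_one 1 (by omega)
    have e23 := step_one 2 (by omega)
    have ek := step_one (2 * k) (by omega)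
    have ek' := step_one (2 * k - 1) (by omega)
    rw [show 2 * k - 1 + 1 = 2 * k by omega] at ek'
    norm_num at e12 e23
    rcases hc with rfl | rfl | ⟨rfl, hD⟩ | ⟨rfl, hD⟩ | rfl | rfl | ⟨x, hx0, hx, rfl, hlt⟩
    · exact ⟨2, by omega, by omega, by omega, by omega, by omega⟩
    · exact ⟨1, by omega, by omega, by omega, by omega, by omega⟩
    · exact ⟨2, by omega, by omega, by omega, by omega, by omega⟩
    · exact ⟨2 * k, by omega, by omega, by omega, by omega, by omega⟩
    · exact ⟨2 * k + 1, by omega, by omega, by omega, by omega, by omega⟩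
    · exact ⟨2 * k, by omega, by omega, by omega, by omega, by omega⟩
    · obtain ⟨y, rfl⟩ : ∃ y, x = y + 1 := ⟨x - 1, by omega⟩
      by_cases hy : y = 0 ∧ 2 ≤ D
      · obtain ⟨rfl, hD⟩ := hy
        exact ⟨2, by omega, by omega, by omega, by omega, by norm_num; omega⟩
      · have h1 := hub_odd y (by omega) (hchain y hx hlt)
        have h2 := step_two (2 * y + 1) (by omega) (by omega) (by omega)
        rw [show 2 * y + 1 + 2 = 2 * (y + 1) + 1 by ring] at h2
        exact ⟨2 * y + 1, by omega, by omega, by omega, by omega, by omega⟩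

lemma mult_self (k D : ℕ) (d : ℕ → ℕ) (i : ℕ) (hk : 2 ≤ k) : mult k D d i i = 0 := by
  simp only [mult, forward]; grind

lemma sum_range_odd (k : ℕ) (f : ℕ → ℕ) :
    ∑ j ∈ Finset.range (2 * k + 2), (if j % 2 = 1 ∧ j < 2 * k then f j else 0) =
      ∑ i ∈ Finset.range k, f (2 * i + 1) := by
  have key : ∀ m, m ≤ k → ∑ j ∈ Finset.range (2 * m),
      (if j % 2 = 1 ∧ j < 2 * k then f j else 0) = ∑ i ∈ Finset.range m, f (2 * i + 1) := by
    intro m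
    induction m with
    | zero => simp
    | succ m ih =>
      intro hm
      rw [show 2 * (m + 1) = 2 * m + 1 + 1 by ring, Finset.sum_range_succ, Finset.sum_range_succ,
        ih (by omega), Finset.sum_range_succ, if_neg (by omega), if_pos (by omega)]
      simp
  rw [Finset.sum_range_succ, Finset.sum_range_succ, key k le_rfl, if_neg (by omega),
    if_neg (by omega)]
  simp

lemma sum_range_ite_eq_add (n i w : ℕ) (f : ℕ → ℕ) (hw : ∀ j, j + w = i → j < n) :
    ∑ j ∈ Finset.range n, (if i = j + w then f j else 0) = if w ≤ i then f (i - w) else 0 := by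
  split_ifs with h
  · rw [Finset.sum_eq_single (i - w)]
    · rw [if_pos (by omega)]
    · intro b _ hb
      rw [if_neg (by omega)]
    · intro hb
      exact absurd (Finset.mem_range.2 (hw _ (by omega))) hb
  · exact Finset.sum_eq_zero fun j _ => if_neg (by omega)

lemma sum_forward_left {k D : ℕ} {d : ℕ → ℕ} (hk : 2 ≤ k) {i : ℕ} (hi : i ≠ 0)
    (hin : i < 2 * k + 2) :
    ∑ j ∈ Finset.range (2 * k + 2), forward k D d i j =
      (if i < 2 * k + 1 then 1 + if i % 2 = 1 then d (i + 1) - 4 else 0 else 0) +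
      (if i < 2 * k then
        if (i = 1 ∧ 2 ≤ D) ∨ (i + 1 = 2 * k ∧ 4 ≤ D) then 0 else 1 else 0) +
      (if i = 1 then 1 else 0) := by
  simp only [forward, Finset.sum_add_distrib, hi, if_false, false_or, ite_and,
    Finset.sum_ite_eq', Finset.mem_range, Finset.sum_const_zero]
  by_cases h1 : i = 1
  · subst h1
    simp [show 3 < 2 * k + 2 by omega, show 1 < 2 * k by omega]
  · simp [h1]

lemma sum_forward_right {k D : ℕ} {d : ℕ → ℕ} (hk : 2 ≤ k) {i : ℕ}
    (hin : i < 2 * k + 2) :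
    ∑ j ∈ Finset.range (2 * k + 2), forward k D d j i =
      (if 1 ≤ i then if i - 1 = 0 then 0 else
        1 + if (i - 1) % 2 = 1 then d (i - 1 + 1) - 4 else 0 else 0) +
      (if 2 ≤ i then if i - 2 = 0 ∨ (i - 2 = 1 ∧ 2 ≤ D) ∨ (i - 2 + 1 = 2 * k ∧ 4 ≤ D) then 0
        else 1 else 0) +
      (if i = 2 * k + 1 then 1 else 0) + forward k D d 0 i := by
  have hsplit (j : ℕ) : forward k D d j i =
      (if i = j + 1 then if j = 0 then 0 else 1 + if j % 2 = 1 then d (j + 1) - 4 else 0 else 0) +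
      (if i = j + 2 then
        if j = 0 ∨ (j = 1 ∧ 2 ≤ D) ∨ (j + 1 = 2 * k ∧ 4 ≤ D) then 0 else 1 else 0) +
      (if j = 1 then if i = 2 * k + 1 then 1 else 0 else 0) +
      (if j = 0 then forward k D d 0 i else 0) := by
    by_cases hj : j = 0
    · subst hj
      simp [forward]
    · simp [forward, hj, ite_and]
  rw [Finset.sum_congr rfl fun j _ => hsplit j]
  simp only [Finset.sum_add_distrib, Finset.sum_ite_eq', Finset.mem_range]
  rw [sum_range_ite_eq_add _ _ _ _ (by omega), sum_range_ite_eq_add _ _ _ _ (by omega),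
    if_pos (show 1 < 2 * k + 2 by omega), if_pos (show 0 < 2 * k + 2 by omega)]

lemma sum_forward_zero {k D : ℕ} {d : ℕ → ℕ} (hk : 2 ≤ k) :
    ∑ j ∈ Finset.range (2 * k + 2), forward k D d 0 j =
      4 + (if 2 ≤ D then 2 else 0) + (if 4 ≤ D then 2 else 0) + (d (2 * k + 1) - 4) +
        ∑ i ∈ Finset.range k, (d (2 * i + 1) - d (2 * i + 2)) := by
  have e (w : ℕ) : ∑ j ∈ Finset.range (2 * k + 2), (if j + 1 = 2 * k then w else 0) = w := by
    rw [Finset.sum_congr rfl fun j _ => if_congr (show j + 1 = 2 * k ↔ j = 2 * k - 1 by omega)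
      rfl rfl, Finset.sum_ite_eq', if_pos (Finset.mem_range.2 (by omega))]
  have hsplit (j : ℕ) : forward k D d 0 j =
      (if j = 1 then if 2 ≤ D then 2 else 1 else 0) +
      (if j = 2 then 1 else 0) +
      (if j = 3 then if 2 ≤ D then 1 else 0 else 0) +
      (if j + 1 = 2 * k then if 4 ≤ D then 1 else 0 else 0) +
      (if j = 2 * k then 1 else 0) +
      (if j = 2 * k + 1 then (if 4 ≤ D then 2 else 1) + (d j - 4) else 0) +
      (if j % 2 = 1 ∧ j < 2 * k then d j - d (j + 1) else 0) := by
    simp [forward]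
  simp only [hsplit, Finset.sum_add_distrib, Finset.sum_ite_eq', Finset.mem_range]
  rw [sum_range_odd k fun j => d j - d (j + 1), e]
  rw [if_pos (show 1 < 2 * k + 2 by omega), if_pos (show 2 < 2 * k + 2 by omega),
    if_pos (show 3 < 2 * k + 2 by omega),
    if_pos (show 2 * k < 2 * k + 2 by omega), if_pos (show 2 * k + 1 < 2 * k + 2 by omega)]
  split_ifs <;> simp only [add_assoc, Nat.reduceAdd] <;> omega

lemma sum_mult {k D : ℕ} {d : ℕ → ℕ} (hk : 2 ≤ k) (hD : D = 0 ∨ D = 2 ∨ D = 4)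
    (hpair : ∀ i < k, d (2 * i + 2) ≤ d (2 * i + 1)) (hfour : ∀ i < k, 4 ≤ d (2 * i + 2))
    (hlast : 4 ≤ d (2 * k + 1))
    (hzero : d 0 = ∑ i ∈ Finset.range k, (d (2 * i + 1) - d (2 * i + 2)) + d (2 * k + 1) + D)
    {i : ℕ} (hi : i < 2 * k + 2) :
    ∑ j ∈ Finset.range (2 * k + 2), mult k D d i j = d i := by
  simp only [mult, Finset.sum_add_distrib]
  by_cases h0 : i = 0
  · subst h0
    have hback : ∑ j ∈ Finset.range (2 * k + 2), forward k D d j 0 = 0 :=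
      Finset.sum_eq_zero fun j _ => by simp [forward]; omega
    rw [sum_forward_zero hk, hback, hzero]
    rcases hD with rfl | rfl | rfl <;> simp <;> omega
  · rw [sum_forward_left hk h0 hi, sum_forward_right hk hi]
    rcases Nat.even_or_odd' i with ⟨x, rfl | rfl⟩
    · obtain ⟨y, rfl⟩ : ∃ y, x = y + 1 := ⟨x - 1, by omega⟩
      have h4 := hfour y (by omega)
      rw [show 2 * (y + 1) - 1 + 1 = 2 * y + 2 by omega]
      simp only [forward, show 2 * (y + 1) = 2 * y + 2 by ring] at h4 ⊢
      grind (splits := 30)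
    · rcases eq_or_ne x k with rfl | hx
      · simp only [forward]
        grind (splits := 30)
      · have h4 := hfour x (by omega)
        have hp := hpair x (by omega)
        simp only [forward, add_assoc, Nat.reduceAdd]
        grind (splits := 30)

/-- Realization of a degree sequence in which the pairs `(2i + 1, 2i + 2)` of unequal degrees
come first. -/
lemma exists_of_unequal_pairs_first {k D : ℕ} {d : ℕ → ℕ} (hk : 2 ≤ k)
    (hD : D = 0 ∨ D = 2 ∨ D = 4)
    (hpair : ∀ i < k, d (2 * i + 2) ≤ d (2 * i + 1)) (hfour : ∀ i < k, 4 ≤ d (2 * i + 2))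
    (hlast : 4 ≤ d (2 * k + 1))
    (hzero : d 0 = ∑ i ∈ Finset.range k, (d (2 * i + 1) - d (2 * i + 2)) + d (2 * k + 1) + D)
    (hchain : ∀ i, i + 1 < k → d (2 * i + 4) < d (2 * i + 3) → d (2 * i + 2) < d (2 * i + 1)) :
    ∃ m : Fin (2 * k + 2) → Fin (2 * k + 2) → ℕ,
      (∀ i j, m i j = m j i) ∧ (∀ i, m i i = 0) ∧ Triangular m ∧ ∀ i, ∑ j, m i j = d i := by
  refine ⟨fun i j => mult k D d i j, fun i j => Nat.add_comm _ _, fun i => mult_self k D d i hk,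
    fun i j _ h => ?_, fun i => ?_⟩
  · rcases Nat.add_pos_iff_pos_or_pos.1 h with h | h
    · obtain ⟨l, hl, hli, hlj, h1, h2⟩ := forward_triangle hk hchain j.isLt h
      exact ⟨⟨l, hl⟩, Fin.ne_of_val_ne hli, Fin.ne_of_val_ne hlj, h1, h2⟩
    · obtain ⟨l, hl, hlj, hli, h1, h2⟩ := forward_triangle hk hchain i.isLt h
      exact ⟨⟨l, hl⟩, Fin.ne_of_val_ne hli, Fin.ne_of_val_ne hlj, h2, h1⟩
  · rw [← sum_mult hk hD hpair hfour hlast hzero i.isLt, Finset.sum_range]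

/-- Realizability of a degree sequence is invariant under relabelling the vertices. -/
lemma exists_of_perm {n : ℕ} {d : Fin n → ℕ} (e : Equiv.Perm (Fin n))
    (h : ∃ m : Fin n → Fin n → ℕ, (∀ i j, m i j = m j i) ∧ (∀ i, m i i = 0) ∧ Triangular m ∧
      ∀ i, ∑ j, m i j = d (e i)) :
    ∃ m : Fin n → Fin n → ℕ, (∀ i j, m i j = m j i) ∧ (∀ i, m i i = 0) ∧ Triangular m ∧
      ∀ i, ∑ j, m i j = d i := by
  obtain ⟨m, hsymm, hdiag, htri, hdeg⟩ := h
  refine ⟨fun i j => m (e.symm i) (e.symm j), fun i j => hsymm _ _, fun i => hdiag _,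
    fun i j hij hm => ?_, fun i => ?_⟩
  · obtain ⟨l, hli, hlj, h1, h2⟩ := htri _ _ (e.symm.injective.ne hij) hm
    refine ⟨e l, ?_, ?_, by simpa using h1, by simpa using h2⟩
    · rintro rfl
      simp at hli
    · rintro rfl
      simp at hlj
  · rw [Equiv.sum_comp e.symm fun j => m (e.symm i) j, hdeg, e.apply_symm_apply]

/-- The map on vertices that moves the pair `(2i + 1, 2i + 2)` to the pair with index `t i`. -/
def pairMap (t : ℕ → ℕ) (x : ℕ) : ℕ := if x = 0 then 0 else 2 * t ((x - 1) / 2) + 1 + (x - 1) % 2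

lemma pairMap_odd (t : ℕ → ℕ) (i : ℕ) : pairMap t (2 * i + 1) = 2 * t i + 1 := by
  simp [pairMap]

lemma pairMap_even (t : ℕ → ℕ) (i : ℕ) : pairMap t (2 * i + 2) = 2 * t i + 2 := by
  simp [pairMap, show (2 * i + 1) / 2 = i by omega]

lemma pairMap_injective {t : ℕ → ℕ} (ht : Function.Injective t) :
    Function.Injective (pairMap t) := by
  intro x y hxy
  simp only [pairMap] at hxy
  split_ifs at hxy with hx hy hy
  · omega
  · omega
  · omega
  · have := @ht ((x - 1) / 2) ((y - 1) / 2) (by omega)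
    omega

lemma sum_alternating (k : ℕ) (d : ℕ → ℤ) :
    ∑ i ∈ Finset.range (2 * k + 2), (-1) ^ i * d i =
      d 0 - ∑ i ∈ Finset.range k, (d (2 * i + 1) - d (2 * i + 2)) - d (2 * k + 1) := by
  induction k with
  | zero => simp [Finset.sum_range_succ]; ring
  | succ k ih =>
    rw [show 2 * (k + 1) + 2 = 2 * k + 2 + 1 + 1 by ring, Finset.sum_range_succ,
      Finset.sum_range_succ, ih, Finset.sum_range_succ _ k,
      Even.neg_one_pow ⟨k + 1, by ring⟩, Odd.neg_one_pow ⟨k + 1, by ring⟩]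
    ring_nf

/-- A permutation of an initial segment, extended by the identity, that sorts `f` decreasingly. -/
lemma exists_sorting (k : ℕ) (f : ℕ → ℕ) :
    ∃ t : ℕ → ℕ, Function.Injective t ∧ (∀ i < k, t i < k) ∧ t k = k ∧
      (∀ i, i + 1 < k → f (t (i + 1)) ≤ f (t i)) ∧
      ∑ i ∈ Finset.range k, f (t i) = ∑ i ∈ Finset.range k, f i := by
  let g : Fin k → ℕᵒᵈ := fun i => OrderDual.toDual (f i)
  let σ := Tuple.sort g
  refine ⟨fun i => if h : i < k then σ ⟨i, h⟩ else i, ?_, ?_, by simp, ?_, ?_⟩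
  · intro x y hxy
    dsimp only at hxy
    split_ifs at hxy with hx hy hy
    · simpa using σ.injective (Fin.ext hxy)
    · have := (σ ⟨x, hx⟩).isLt
      omega
    · have := (σ ⟨y, hy⟩).isLt
      omega
    · exact hxy
  · intro i hi
    simp [hi]
  · intro i hi
    have h := Tuple.monotone_sort g
      (show (⟨i, by omega⟩ : Fin k) ≤ ⟨i + 1, hi⟩ from Nat.le_succ i)
    simpa [hi, show i < k by omega] using OrderDual.toDual_le_toDual.1 h
  · rw [Finset.sum_range, Finset.sum_range]
    simpa using Equiv.sum_comp σ fun i : Fin k => f i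

end TriangularMultigraph

open TriangularMultigraph in
theorem stmt_10 (n : ℕ) (hn : 6 ≤ n) (heven : Even n) (d : Fin n → ℕ)
    (hanti : ∀ i j : Fin n, 1 ≤ (i : ℕ) → i ≤ j → d j ≤ d i)
    (h4 : ∀ i : Fin n, 1 ≤ (i : ℕ) → 4 ≤ d i)
    (hD : ∑ i : Fin n, (-1 : ℤ) ^ (i : ℕ) * (d i : ℤ) ∈ ({0, 2, 4} : Set ℤ)) :
    ∃ m : Fin n → Fin n → ℕ,
      (∀ i j : Fin n, m i j = m j i) ∧
      (∀ i : Fin n, m i i = 0) ∧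
      Triangular m ∧
      (∀ i : Fin n, ∑ j, m i j = d i) := by
  obtain ⟨k, rfl⟩ : ∃ k, n = 2 * k + 2 := by
    obtain ⟨r, rfl⟩ := heven
    exact ⟨r - 1, by omega⟩
  obtain ⟨c, rfl⟩ : ∃ c : ℕ → ℕ, d = fun i : Fin (2 * k + 2) => c i :=
    ⟨fun i => if h : i < 2 * k + 2 then d ⟨i, h⟩ else 0, by ext i; simp⟩
  have hpair (i : ℕ) (hi : i < k) : c (2 * i + 2) ≤ c (2 * i + 1) :=
    hanti ⟨2 * i + 1, by omega⟩ ⟨2 * i + 2, by omega⟩ (by simp) (by simp)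
  have hfour (i : ℕ) (hi : i < k) : 4 ≤ c (2 * i + 2) := h4 ⟨2 * i + 2, by omega⟩ (by simp)
  have hlast : 4 ≤ c (2 * k + 1) := h4 ⟨2 * k + 1, by omega⟩ (by simp)
  have hcast : ∑ i ∈ Finset.range k, ((c (2 * i + 1) : ℤ) - c (2 * i + 2)) =
      (∑ i ∈ Finset.range k, (c (2 * i + 1) - c (2 * i + 2)) : ℕ) := by
    rw [Nat.cast_sum]
    exact Finset.sum_congr rfl fun i hi => (Nat.cast_sub (hpair i (Finset.mem_range.1 hi))).symm
  rw [← Finset.sum_range fun i => (-1 : ℤ) ^ i * (c i : ℤ), sum_alternating k fun i => (c i : ℤ),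
    hcast] at hD
  obtain ⟨D, hD', hzero⟩ : ∃ D, (D = 0 ∨ D = 2 ∨ D = 4) ∧
      c 0 = ∑ i ∈ Finset.range k, (c (2 * i + 1) - c (2 * i + 2)) + c (2 * k + 1) + D := by
    simp only [Set.mem_insert_iff, Set.mem_singleton_iff] at hD
    rcases hD with h | h | h
    · exact ⟨0, by omega, by omega⟩
    · exact ⟨2, by omega, by omega⟩
    · exact ⟨4, by omega, by omega⟩
  obtain ⟨t, htinj, htlt, htk, htsort, htsum⟩ :=
    exists_sorting k fun i => c (2 * i + 1) - c (2 * i + 2)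
  have hmaps (x : ℕ) (hx : x < 2 * k + 2) : pairMap t x < 2 * k + 2 := by
    rcases Nat.lt_or_ge ((x - 1) / 2) k with h | h
    · have := htlt _ h
      simp only [pairMap]
      split_ifs <;> omega
    · obtain rfl : x = 2 * k + 1 := by omega
      rw [pairMap_odd, htk]
      omega
  let e : Equiv.Perm (Fin (2 * k + 2)) := Equiv.ofBijective
    (fun x => ⟨pairMap t x, hmaps x x.isLt⟩) <| Finite.injective_iff_bijective.1 fun x y hxy =>
      Fin.ext (pairMap_injective htinj (Fin.mk.inj_iff.1 hxy))
  refine exists_of_perm e (exists_of_unequal_pairs_first (d := fun x => c (pairMap t x)) (D := D)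
    (by omega) hD' ?_ ?_ ?_ ?_ ?_)
  · intro i hi
    simpa only [pairMap_odd, pairMap_even] using hpair _ (htlt i hi)
  · intro i hi
    simpa only [pairMap_even] using hfour _ (htlt i hi)
  · simpa only [pairMap_odd, htk] using hlast
  · simp only [pairMap_odd, pairMap_even, htk, htsum]
    exact hzero
  · intro i hi hlt
    have h := htsort i hi
    rw [show 2 * i + 4 = 2 * (i + 1) + 2 by ring, show 2 * i + 3 = 2 * (i + 1) + 1 by ring] at hlt
    simp only [pairMap_odd, pairMap_even] at hlt h ⊢
    omega
end

section
/- Let d₁ ≥ d₂ ≥ d₃ ≥ d₄ ≥ 4 be positive integers with d₁ + d₂ + d₃ + d₄ even and d₁ ≤ (d₂ − 1) + (d₃ − 1) + (d₄ − 1). Then there exists a triangular multigraph on 4 vertices v₁, v₂, v₃, v₄ with deg(vᵢ) = dᵢ for i = 1, 2, 3, 4. -/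
/-- The symmetric multiplicity function on four vertices with the given edge multiplicities. -/
def fourVertexMultigraph (a b c e f g : ℕ) : Fin 4 → Fin 4 → ℕ :=
  ![![0, a, b, c], ![a, 0, e, f], ![b, e, 0, g], ![c, f, g, 0]]

/-- If all edges except possibly the one joining vertices `2` and `3` are present, the multigraph
is triangular. -/
theorem triangular_fourVertexMultigraph {a b c e f : ℕ} (g : ℕ) (ha : 0 < a) (hb : 0 < b)
    (hc : 0 < c) (he : 0 < e) (hf : 0 < f) :
    Triangular (fourVertexMultigraph a b c e f g) := by
  intro i j hij _
  fin_cases i <;> fin_cases j <;>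
    simp_all [fourVertexMultigraph, Fin.exists_fin_succ]

/-- Edge multiplicities realizing the degrees, with every edge off the pair of smallest-degree
vertices present. -/
theorem exists_edge_multiplicities {d₁ d₂ d₃ d₄ : ℕ} (h12 : d₂ ≤ d₁) (h23 : d₃ ≤ d₂)
    (h34 : d₄ ≤ d₃) (h4 : 4 ≤ d₄) (heven : Even (d₁ + d₂ + d₃ + d₄))
    (hd1 : d₁ ≤ (d₂ - 1) + (d₃ - 1) + (d₄ - 1)) :
    ∃ a b c e f g : ℕ, 0 < a ∧ 0 < b ∧ 0 < c ∧ 0 < e ∧ 0 < f ∧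
      a + b + c = d₁ ∧ a + e + f = d₂ ∧ b + e + g = d₃ ∧ c + f + g = d₄ := by
  obtain ⟨k, hk⟩ := heven
  obtain ⟨T, hT⟩ : ∃ T, d₁ + 2 * T = d₂ + d₃ + d₄ := ⟨k - d₁, by omega⟩
  rcases le_total T d₄ with h | h
  · exact ⟨d₂ - 2, d₃ + 1 - T, d₄ + 1 - T, 1, 1, T - 2, by omega⟩
  · exact ⟨d₂ + d₄ - T - 2, d₃ + 1 - T, 1, T + 1 - d₄, 1, d₄ - 2, by omega⟩

theorem stmt_12 (d₁ d₂ d₃ d₄ : ℕ) (h12 : d₂ ≤ d₁) (h23 : d₃ ≤ d₂) (h34 : d₄ ≤ d₃)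
    (h4 : 4 ≤ d₄)
    (heven : Even (d₁ + d₂ + d₃ + d₄))
    (hd1 : d₁ ≤ (d₂ - 1) + (d₃ - 1) + (d₄ - 1)) :
    ∃ m : Fin 4 → Fin 4 → ℕ,
      (∀ i j : Fin 4, m i j = m j i) ∧
      (∀ i : Fin 4, m i i = 0) ∧
      Triangular m ∧
      (∑ j, m 0 j = d₁) ∧ (∑ j, m 1 j = d₂) ∧ (∑ j, m 2 j = d₃) ∧ (∑ j, m 3 j = d₄) := by
  obtain ⟨a, b, c, e, f, g, ha, hb, hc, he, hf, h₁, h₂, h₃, h₄⟩ :=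
    exists_edge_multiplicities h12 h23 h34 h4 heven hd1
  refine ⟨fourVertexMultigraph a b c e f g, ?_, ?_,
    triangular_fourVertexMultigraph g ha hb hc he hf, ?_, ?_, ?_, ?_⟩
  · intro i j
    fin_cases i <;> fin_cases j <;> rfl
  · intro i
    fin_cases i <;> rfl
  all_goals simpa [fourVertexMultigraph, Fin.sum_univ_four]
end
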